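/- Fix an integer r ≥ 1. There is a constant C_r such that the following holds for X large and any T ≥ 1. Let Z_r ≥ Z_{r−1} ≥ … ≥ Z_1 ≥ 1 with Z_r ≥ exp(log X/(log log X)³), let Z_r ≤ z ≤ 4X, and let Q = {n ≤ 4X : n = p_1⋯p_r·m with p_i ∈ [Z_i, Z_i²] for each i, and (m, P(z)) = 1}. Let (a_n) satisfy |a_n| ≤ 1_Q(n), and set X_1 = exp(log X/(log log X)⁴), S_1(X,(a_n)) = max over X/X_1 ≤ Y ≤ 4X and 1 ≤ H ≤ (log X)^{10} of H·Σ_{Y ≤ n ≤ Y + Y/H} |a_n|²/n, and S_2(X,(a_n)) = max over the same range of H·Σ_{1 ≤ h ≤ X/T} Σ_{Y ≤ n ≤ Y + Y/H} |a_n|·|a_{n+h}|/n. Then S_1(X,(a_n)) ≤ C_r/log z and S_2(X,(a_n)) ≤ C_r·(X/T)/(log z)². -/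

import Mathlib

open scoped Classical

/-- The set `Q` of `n ≤ 4X` of the form `n = p₁⋯p_r·m` with primes `p_i ∈ [Z_i, Z_i²]`
(indexed `1 ≤ i ≤ r`) and `m` free of prime factors below `z`. -/
def sievedSet (X : ℝ) (r : ℕ) (Z : ℕ → ℝ) (z : ℝ) : Set ℕ :=
  {n : ℕ | (n : ℝ) ≤ 4 * X ∧ ∃ (p : ℕ → ℕ) (m : ℕ),
    (∀ i ∈ Finset.Icc 1 r, (p i).Prime ∧ Z i ≤ (p i : ℝ) ∧ (p i : ℝ) ≤ Z i ^ 2) ∧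
    n = (∏ i ∈ Finset.Icc 1 r, p i) * m ∧
    ∀ q : ℕ, q.Prime → (q : ℝ) < z → ¬ q ∣ m}

namespace BoundingSieve

open Finset Nat ArithmeticFunction

/-- The denominator in the Selberg sieve of level `D ^ 2`. -/
noncomputable def selbergDenom (s : BoundingSieve) (D : ℕ) : ℝ :=
  ∑ l ∈ s.prodPrimes.divisors with l ≤ D, s.selbergTerms l

/-- The optimal Selberg weights supported on divisors `d ≤ D`. -/
noncomputable def selbergWeight (s : BoundingSieve) (D d : ℕ) : ℝ :=
  (moebius d : ℝ) * (s.nu d)⁻¹ * (s.selbergDenom D)⁻¹ *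
    ∑ l ∈ s.prodPrimes.divisors with l ≤ D, if d ∣ l then s.selbergTerms l else 0

variable {s : BoundingSieve} {D : ℕ}

theorem selbergDenom_pos (hD : 1 ≤ D) : 0 < s.selbergDenom D := by
  refine sum_pos (fun l hl => selbergTerms_pos (dvd_of_mem_divisors (mem_filter.1 hl).1)) ⟨1, ?_⟩
  simpa [prodPrimes_ne_zero] using hD

theorem selbergWeight_one (hD : 1 ≤ D) : s.selbergWeight D 1 = 1 := by
  have h := (selbergDenom_pos (s := s) hD).ne'
  have : (∑ l ∈ s.prodPrimes.divisors with l ≤ D, if 1 ∣ l then s.selbergTerms l else 0)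
      = s.selbergDenom D := by simp [selbergDenom]
  simp only [selbergWeight, this, s.nu_mult.map_one, moebius_apply_one]
  field_simp
  simp

theorem selbergWeight_eq_zero {d : ℕ} (hd : D < d) : s.selbergWeight D d = 0 := by
  rw [selbergWeight, sum_eq_zero, mul_zero]
  intro l hl
  rw [if_neg]
  intro hdl
  have hl' := mem_filter.1 hl
  have := Nat.le_of_dvd (Nat.pos_of_mem_divisors hl'.1) hdl
  omega

theorem abs_selbergWeight_le (hD : 1 ≤ D) {d : ℕ} (hd : d ∣ s.prodPrimes) :
    |s.selbergWeight D d| ≤ (s.nu d)⁻¹ := by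
  have hS := selbergDenom_pos (s := s) hD
  have hν := nu_pos_of_dvd_prodPrimes hd
  have hg : ∀ l ∈ s.prodPrimes.divisors.filter (· ≤ D), 0 ≤ s.selbergTerms l :=
    fun l hl => (selbergTerms_pos (dvd_of_mem_divisors (mem_filter.1 hl).1)).le
  have h0 : 0 ≤ ∑ l ∈ s.prodPrimes.divisors with l ≤ D,
      if d ∣ l then s.selbergTerms l else 0 :=
    sum_nonneg fun l hl => by split_ifs <;> [exact hg l hl; exact le_rfl]
  have h1 : (∑ l ∈ s.prodPrimes.divisors with l ≤ D,
      if d ∣ l then s.selbergTerms l else 0) ≤ s.selbergDenom D :=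
    sum_le_sum fun l hl => by split_ifs <;> [exact le_rfl; exact hg l hl]
  have hμ : |(moebius d : ℝ)| ≤ 1 := by exact_mod_cast abs_moebius_le_one
  rw [selbergWeight, abs_mul, abs_mul, abs_mul, abs_of_pos (inv_pos.2 hν),
    abs_of_pos (inv_pos.2 hS), abs_of_nonneg h0]
  calc _ ≤ 1 * (s.nu d)⁻¹ * (s.selbergDenom D)⁻¹ * s.selbergDenom D := by gcongr
    _ = (s.nu d)⁻¹ := by field_simp

theorem sum_moebius_of_dvd_of_dvd {l e : ℕ} (he : Squarefree e) :
    (∑ d ∈ e.divisors, if l ∣ d then (moebius d : ℝ) else 0) =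
      if l = e then (moebius l : ℝ) else 0 := by
  by_cases hle : l ∣ e
  · obtain ⟨k, rfl⟩ := hle
    have hcop := coprime_of_squarefree_mul he
    have hl0 : l ≠ 0 := left_ne_zero_of_mul he.ne_zero
    have hk0 : k ≠ 0 := right_ne_zero_of_mul he.ne_zero
    rw [← sum_filter]
    have : (l * k).divisors.filter (l ∣ ·) = k.divisors.image (l * ·) := by
      ext d
      simp only [mem_filter, mem_divisors, mem_image]
      constructor
      · rintro ⟨⟨h, -⟩, c, rfl⟩
        exact ⟨c, ⟨Nat.dvd_of_mul_dvd_mul_left (Nat.pos_of_ne_zero hl0) h, hk0⟩, rfl⟩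
      · rintro ⟨c, ⟨h, -⟩, rfl⟩
        exact ⟨⟨Nat.mul_dvd_mul_left l h, he.ne_zero⟩, dvd_mul_right _ _⟩
    rw [this, sum_image (fun a _ b _ h => Nat.eq_of_mul_eq_mul_left (Nat.pos_of_ne_zero hl0) h)]
    have h2 : ∀ c ∈ k.divisors, (moebius (l * c) : ℝ) = moebius l * moebius c := by
      intro c hc
      rw [isMultiplicative_moebius.map_mul_of_coprime
        (hcop.coprime_dvd_right (dvd_of_mem_divisors hc))]
      push_cast; rfl
    rw [sum_congr rfl h2, ← mul_sum]
    have h3 : (∑ c ∈ k.divisors, (moebius c : ℝ)) = if k = 1 then 1 else 0 := by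
      have := congrArg (fun f => f k) (moebius_mul_coe_zeta)
      rw [mul_comm] at this
      simp only [coe_zeta_mul_apply, one_apply] at this
      exact_mod_cast this
    rw [h3]
    by_cases hk : k = 1
    · simp [hk]
    · rw [if_neg hk, if_neg, mul_zero]
      intro h
      exact hk (Nat.eq_of_mul_eq_mul_left (Nat.pos_of_ne_zero hl0) (by simpa using h.symm))
  · rw [if_neg (by rintro rfl; exact hle dvd_rfl)]
    refine sum_eq_zero fun d hd => if_neg fun h => hle (h.trans (dvd_of_mem_divisors hd))

theorem sum_nu_mul_selbergWeight {l : ℕ} (hl : l ∣ s.prodPrimes) :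
    (∑ d ∈ s.prodPrimes.divisors, if l ∣ d then s.nu d * s.selbergWeight D d else 0) =
      if l ≤ D then (moebius l : ℝ) * s.selbergTerms l * (s.selbergDenom D)⁻¹ else 0 := by
  have h1 : ∀ d ∈ s.prodPrimes.divisors, (if l ∣ d then s.nu d * s.selbergWeight D d else 0) =
      ∑ e ∈ s.prodPrimes.divisors with e ≤ D, (s.selbergDenom D)⁻¹ * s.selbergTerms e *
        (if d ∣ e then (if l ∣ d then (moebius d : ℝ) else 0) else 0) := by
    intro d hd
    have := nu_ne_zero (s := s) (dvd_of_mem_divisors hd)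
    split_ifs with h
    · rw [selbergWeight, mul_sum, mul_sum]
      refine sum_congr rfl fun e _ => ?_
      split_ifs
      · field_simp
      · simp
    · simp
  rw [sum_congr rfl h1, sum_comm]
  have h2 : ∀ e ∈ s.prodPrimes.divisors.filter (· ≤ D),
      (∑ d ∈ s.prodPrimes.divisors, (s.selbergDenom D)⁻¹ * s.selbergTerms e *
        (if d ∣ e then (if l ∣ d then (moebius d : ℝ) else 0) else 0)) =
      if l = e then (s.selbergDenom D)⁻¹ * s.selbergTerms e * moebius l else 0 := by
    intro e he
    have heP := dvd_of_mem_divisors (mem_filter.1 he).1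
    rw [← mul_sum, ← sum_filter, Nat.divisors_filter_dvd_of_dvd prodPrimes_ne_zero heP,
      sum_moebius_of_dvd_of_dvd (squarefree_of_dvd_prodPrimes heP)]
    split_ifs <;> simp
  rw [sum_congr rfl h2, sum_ite_eq]
  simp only [mem_filter, mem_divisors, hl, prodPrimes_ne_zero, ne_eq, not_false_eq_true, true_and]
  split_ifs
  · ring
  · rfl

theorem mainSum_selbergWeight (hD : 1 ≤ D) :
    s.mainSum (lambdaSquared (s.selbergWeight D)) = (s.selbergDenom D)⁻¹ := by
  have hS := (selbergDenom_pos (s := s) hD).ne'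
  rw [mainSum_lambdaSquared_eq_sum_mul_sum_sq]
  have : ∀ l ∈ s.prodPrimes.divisors, (s.selbergTerms l)⁻¹ *
      (∑ d ∈ s.prodPrimes.divisors, if l ∣ d then s.nu d * s.selbergWeight D d else 0) ^ 2 =
      if l ≤ D then s.selbergTerms l * ((s.selbergDenom D)⁻¹) ^ 2 else 0 := by
    intro l hl
    have hl' := dvd_of_mem_divisors hl
    have hg := (selbergTerms_pos (s := s) hl').ne'
    have hμ : (moebius l : ℝ) ^ 2 = 1 := by
      exact_mod_cast moebius_sq_eq_one_of_squarefree (squarefree_of_dvd_prodPrimes hl')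
    rw [sum_nu_mul_selbergWeight hl']
    split_ifs
    · rw [mul_pow, mul_pow, hμ]
      field_simp
    · simp
  rw [sum_congr rfl this, ← sum_filter, ← sum_mul]
  change s.selbergDenom D * _ = _
  field_simp

theorem errSum_lambdaSquared_le (w : ℕ → ℝ) :
    s.errSum (lambdaSquared w) ≤ ∑ d₁ ∈ s.prodPrimes.divisors, ∑ d₂ ∈ s.prodPrimes.divisors,
      |w d₁| * |w d₂| * |s.rem (d₁.lcm d₂)| := by
  have h1 : ∀ d ∈ s.prodPrimes.divisors, |lambdaSquared w d| * |s.rem d| ≤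
      ∑ d₁ ∈ s.prodPrimes.divisors, ∑ d₂ ∈ s.prodPrimes.divisors,
        if d = d₁.lcm d₂ then |w d₁| * |w d₂| * |s.rem d| else 0 := by
    intro d hd
    have hsub := Nat.divisors_subset_of_dvd prodPrimes_ne_zero (dvd_of_mem_divisors hd)
    calc |lambdaSquared w d| * |s.rem d|
        ≤ (∑ d₁ ∈ d.divisors, ∑ d₂ ∈ d.divisors,
          if d = d₁.lcm d₂ then |w d₁| * |w d₂| else 0) * |s.rem d| := by
          gcongr
          refine (abs_sum_le_sum_abs _ _).trans (sum_le_sum fun d₁ _ => ?_)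
          refine (abs_sum_le_sum_abs _ _).trans (sum_le_sum fun d₂ _ => ?_)
          split_ifs <;> simp [abs_mul]
      _ = ∑ d₁ ∈ d.divisors, ∑ d₂ ∈ d.divisors,
          if d = d₁.lcm d₂ then |w d₁| * |w d₂| * |s.rem d| else 0 := by
          simp [sum_mul]
      _ ≤ ∑ d₁ ∈ d.divisors, ∑ d₂ ∈ s.prodPrimes.divisors,
          if d = d₁.lcm d₂ then |w d₁| * |w d₂| * |s.rem d| else 0 := by
          refine sum_le_sum fun d₁ _ => sum_le_sum_of_subset_of_nonneg hsub fun d₂ _ _ => ?_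
          split_ifs <;> positivity
      _ ≤ _ := by
          refine sum_le_sum_of_subset_of_nonneg hsub fun d₁ _ _ => sum_nonneg fun d₂ _ => ?_
          split_ifs <;> positivity
  refine (sum_le_sum h1).trans (le_of_eq ?_)
  rw [sum_comm]
  refine sum_congr rfl fun d₁ hd₁ => ?_
  rw [sum_comm]
  refine sum_congr rfl fun d₂ hd₂ => ?_
  rw [sum_ite_eq_of_mem' _ _ (fun d => |w d₁| * |w d₂| * |s.rem d|)]
  exact mem_divisors.2 ⟨Nat.lcm_dvd (dvd_of_mem_divisors hd₁) (dvd_of_mem_divisors hd₂),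
    prodPrimes_ne_zero⟩

/-- **Selberg's upper bound sieve**, with a crude bound for the weights in the error term. -/
theorem siftedSum_le_selberg (hD : 1 ≤ D) :
    s.siftedSum ≤ s.totalMass / s.selbergDenom D +
      ∑ d₁ ∈ s.prodPrimes.divisors with d₁ ≤ D, ∑ d₂ ∈ s.prodPrimes.divisors with d₂ ≤ D,
        (s.nu d₁)⁻¹ * (s.nu d₂)⁻¹ * |s.rem (d₁.lcm d₂)| := by
  refine (siftedSum_le_mainSum_errSum_of_upperMoebius _
    (upperMoebius_lambdaSquared _ (selbergWeight_one (s := s) hD))).trans ?_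
  rw [mainSum_selbergWeight hD, ← div_eq_mul_inv]
  refine add_le_add le_rfl ((errSum_lambdaSquared_le _).trans ?_)
  rw [sum_filter]
  refine sum_le_sum fun d₁ hd₁ => ?_
  split_ifs with h1
  · rw [sum_filter]
    refine sum_le_sum fun d₂ hd₂ => ?_
    split_ifs with h2
    · have hν := nu_pos_of_dvd_prodPrimes (s := s) (dvd_of_mem_divisors hd₁)
      have := abs_selbergWeight_le (s := s) hD (dvd_of_mem_divisors hd₁)
      have := abs_selbergWeight_le (s := s) hD (dvd_of_mem_divisors hd₂)
      gcongr
    · simp [selbergWeight_eq_zero (not_le.1 h2)]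
  · simp [selbergWeight_eq_zero (not_le.1 h1)]

end BoundingSieve

section

open Finset

theorem abs_card_Ico_filter_modEq_sub_le (A N r v : ℕ) (hr : 0 < r) :
    |(((Ico A (A + N)).filter (· ≡ v [MOD r])).card : ℝ) - N / r| ≤ 1 := by
  have hr' : (0 : ℚ) < r := by exact_mod_cast hr
  have h := Nat.Ico_filter_modEq_card A (A + N) hr v
  set c : ℕ := ((Ico A (A + N)).filter (· ≡ v [MOD r])).card with hc
  set x : ℚ := (((A + N : ℕ) : ℚ) - v) / r with hx
  set y : ℚ := ((A : ℚ) - v) / r with hy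
  have hxy : x - y = N / r := by rw [hx, hy]; push_cast; ring
  have hxy0 : 0 ≤ x - y := by rw [hxy]; positivity
  have h0 : (0 : ℤ) ≤ ⌈x⌉ - ⌈y⌉ := sub_nonneg.2 (Int.ceil_mono (by linarith))
  have h1 : (c : ℤ) = ⌈x⌉ - ⌈y⌉ := by
    rw [← max_eq_left h0, ← h]
  have h2 : (c : ℚ) = ⌈x⌉ - ⌈y⌉ := by exact_mod_cast h1
  have hq : |(c : ℚ) - N / r| ≤ 1 := by
    rw [h2, ← hxy, abs_le]
    have := Int.le_ceil x
    have := Int.ceil_lt_add_one x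
    have := Int.le_ceil y
    have := Int.ceil_lt_add_one y
    constructor <;> linarith
  have := (Rat.cast_le (K := ℝ)).2 hq
  push_cast at this
  exact this

theorem abs_card_Ico_filter_dvd_dvd_add_sub_le (A N h : ℕ) {a b : ℕ} (ha : 0 < a) (hb : 0 < b)
    (hab : a.gcd b ∣ h) :
    |(((Ico A (A + N)).filter fun n => a ∣ n ∧ b ∣ n + h).card : ℝ) - N / (a.lcm b : ℕ)| ≤ 1 := by
  have hcompat : 0 ≡ h * (b - 1) [MOD a.gcd b] :=
    ((Nat.modEq_zero_iff_dvd).2 (hab.mul_right _)).symm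
  obtain ⟨c, hc1, hc2⟩ := Nat.chineseRemainder' hcompat
  have hca : a ∣ c := (Nat.modEq_zero_iff_dvd).1 hc1
  have hcb : b ∣ c + h := by
    have : c + h ≡ h * (b - 1) + h [MOD b] := hc2.add_right h
    refine (Nat.modEq_zero_iff_dvd).1 (this.trans ((Nat.modEq_zero_iff_dvd).2 ⟨h, ?_⟩))
    obtain ⟨k, rfl⟩ : ∃ k, b = k + 1 := ⟨b - 1, by omega⟩
    simp; ring
  have : (Ico A (A + N)).filter (fun n => a ∣ n ∧ b ∣ n + h) =
      (Ico A (A + N)).filter (· ≡ c [MOD a.lcm b]) := by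
    refine filter_congr fun n _ => ?_
    constructor
    · rintro ⟨h1, h2⟩
      have e1 : n ≡ c [MOD a] :=
        ((Nat.modEq_zero_iff_dvd).2 h1).trans ((Nat.modEq_zero_iff_dvd).2 hca).symm
      have e2 : n ≡ c [MOD b] := Nat.ModEq.add_right_cancel' h
        (((Nat.modEq_zero_iff_dvd).2 h2).trans ((Nat.modEq_zero_iff_dvd).2 hcb).symm)
      rw [Nat.modEq_iff_dvd] at e1 e2 ⊢
      exact_mod_cast lcm_dvd e1 e2
    · intro h1
      have e1 : n ≡ c [MOD a] := h1.of_dvd (Nat.dvd_lcm_left a b)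
      have e2 : n + h ≡ c + h [MOD b] := (h1.of_dvd (Nat.dvd_lcm_right a b)).add_right h
      exact ⟨(Nat.modEq_zero_iff_dvd).1 (e1.trans ((Nat.modEq_zero_iff_dvd).2 hca)),
        (Nat.modEq_zero_iff_dvd).1 (e2.trans ((Nat.modEq_zero_iff_dvd).2 hcb))⟩
  rw [this]
  exact abs_card_Ico_filter_modEq_sub_le A N _ c (Nat.lcm_pos ha hb)

theorem gcd_eq_of_dvd_mul_add {d d₁ n h : ℕ} (hd : d ≠ 0) (hdh : d.Coprime h) (h₁ : d₁ ∣ d)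
    (h₁n : d₁ ∣ n) (h₂n : d / d₁ ∣ n + h) : d.gcd n = d₁ := by
  obtain ⟨e, rfl⟩ := h₁
  have hd₁ : 0 < d₁ := Nat.pos_of_ne_zero (left_ne_zero_of_mul hd)
  rw [Nat.mul_div_cancel_left _ hd₁] at h₂n
  obtain ⟨m, rfl⟩ := h₁n
  rw [Nat.gcd_mul_left]
  have ht : e.gcd m ∣ h := (Nat.dvd_add_right ((Nat.gcd_dvd_right e m).mul_left d₁)).1
    ((Nat.gcd_dvd_left e m).trans h₂n)
  have : e.gcd m = 1 := Nat.eq_one_of_dvd_coprimes hdh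
    ((Nat.gcd_dvd_left e m).mul_left d₁) ht
  rw [this, mul_one]

theorem div_gcd_dvd_add {d n h : ℕ} (hd : d ≠ 0) (h' : d ∣ n * (n + h)) :
    d / d.gcd n ∣ n + h := by
  have hg : 0 < d.gcd n := Nat.gcd_pos_of_pos_left _ (Nat.pos_of_ne_zero hd)
  have hcop := Nat.coprime_div_gcd_div_gcd hg
  refine hcop.dvd_of_dvd_mul_left ?_
  refine Nat.dvd_of_mul_dvd_mul_left hg ?_
  rw [Nat.mul_div_cancel' (Nat.gcd_dvd_left d n), ← mul_assoc,
    Nat.mul_div_cancel' (Nat.gcd_dvd_right d n)]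
  exact h'

theorem gcd_mul_mul_of_coprime {P P' d e : ℕ} (hde : d.Coprime e) (hd : d.Coprime P')
    (he : e.Coprime P) : (P * d).gcd (P' * e) = P.gcd P' := by
  rw [Nat.Coprime.gcd_mul_right_cancel _ (hd.mul_right hde),
    Nat.Coprime.gcd_mul_right_cancel_right _ he]

theorem lcm_mul_mul_of_coprime {P P' d e : ℕ} (hP : 0 < P) (hde : d.Coprime e)
    (hd : d.Coprime P') (he : e.Coprime P) : (P * d).lcm (P' * e) = P.lcm P' * (d * e) := by
  have h1 := Nat.gcd_mul_lcm (P * d) (P' * e)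
  rw [gcd_mul_mul_of_coprime hde hd he] at h1
  refine Nat.eq_of_mul_eq_mul_left (Nat.gcd_pos_of_pos_left P' hP) ?_
  rw [h1, ← mul_assoc (P.gcd P'), Nat.gcd_mul_lcm]
  ring

/-- The product of the primes `p < W` not dividing `B`. -/
noncomputable def coprimePrimorial (B W : ℕ) : ℕ :=
  ∏ p ∈ (range W).filter (fun p => p.Prime ∧ ¬ p ∣ B), p

theorem prime_dvd_coprimePrimorial_iff {B W p : ℕ} (hp : p.Prime) :
    p ∣ coprimePrimorial B W ↔ p < W ∧ ¬ p ∣ B := by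
  rw [coprimePrimorial, hp.prime.dvd_finsetProd_iff]
  constructor
  · rintro ⟨q, hq, hpq⟩
    simp only [mem_filter, mem_range] at hq
    rw [(Nat.prime_dvd_prime_iff_eq hp hq.2.1).1 hpq]
    exact ⟨hq.1, hq.2.2⟩
  · rintro ⟨h1, h2⟩
    exact ⟨p, by simp [h1, h2, hp], dvd_rfl⟩

theorem squarefree_coprimePrimorial (B W : ℕ) : Squarefree (coprimePrimorial B W) := by
  refine Finset.squarefree_prod_of_pairwise_isCoprime (fun p hp q hq hpq => ?_) fun p hp => ?_
  · simp only [coe_filter, Set.mem_ofPred_eq] at hp hq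
    exact Nat.coprime_iff_isRelPrime.1 ((Nat.coprime_primes hp.2.1 hq.2.1).2 hpq)
  · exact (mem_filter.1 hp).2.1.prime.squarefree

theorem coprime_of_dvd_coprimePrimorial {B W d : ℕ} (hd : d ∣ coprimePrimorial B W) :
    d.Coprime B := by
  refine Nat.Coprime.coprime_dvd_left hd (Nat.coprime_of_dvd fun p hp h1 h2 => ?_)
  exact ((prime_dvd_coprimePrimorial_iff hp).1 h1).2 h2

theorem dvd_coprimePrimorial {B W l : ℕ} (hl : Squarefree l) (hlB : l.Coprime B)
    (hlW : ∀ p : ℕ, p.Prime → p ∣ l → p < W) : l ∣ coprimePrimorial B W := by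
  rw [← Nat.prod_primeFactors_of_squarefree hl]
  refine prod_dvd_prod_of_subset _ _ _ fun p hp => ?_
  have hp' := Nat.prime_of_mem_primeFactors hp
  have hpl := Nat.dvd_of_mem_primeFactors hp
  simp only [mem_filter, mem_range]
  exact ⟨hlW p hp' hpl, hp', fun h => hp'.one_lt.ne' (Nat.eq_one_of_dvd_coprimes hlB hpl h)⟩

/-- The function `d ↦ τ(d) / d`. -/
noncomputable def divisorDensity : ArithmeticFunction ℝ :=
  ArithmeticFunction.pdiv (↑(ArithmeticFunction.sigma 0)) (↑ArithmeticFunction.id)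

theorem divisorDensity_apply (d : ℕ) : divisorDensity d = (d.divisors.card : ℝ) / d := by
  simp [divisorDensity, ArithmeticFunction.pdiv_apply, ArithmeticFunction.sigma_zero_apply]

theorem divisorDensity_isMultiplicative : divisorDensity.IsMultiplicative :=
  ArithmeticFunction.isMultiplicative_sigma.natCast.pdiv
    ArithmeticFunction.isMultiplicative_id.natCast

theorem divisorDensity_prime {p : ℕ} (hp : p.Prime) : divisorDensity p = 2 / p := by
  rw [divisorDensity_apply, hp.divisors, card_pair hp.one_lt.ne]
  norm_num

/-- The sieve for `n` and `n + h` by the primes `p < W` not dividing `2 * h * P * P'`, where `n`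
runs over the multiples of `P` in `[A, A + N)` such that `P'` divides `n + h`. -/
noncomputable def shiftSieve (P P' h W A N : ℕ) : BoundingSieve where
  support := ((Ico A (A + N)).filter fun n => P ∣ n ∧ P' ∣ n + h).image fun n => n * (n + h)
  prodPrimes := coprimePrimorial (2 * h * P * P') W
  prodPrimes_squarefree := squarefree_coprimePrimorial _ _
  weights := fun _ => 1
  weights_nonneg := fun _ => zero_le_one
  totalMass := N / (P.lcm P' : ℕ)
  nu := divisorDensity
  nu_mult := divisorDensity_isMultiplicative
  nu_pos_of_prime := fun p hp _ => by
    have := hp.pos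
    rw [divisorDensity_prime hp]
    positivity
  nu_lt_one_of_prime := fun p hp hpd => by
    have h2 : ¬ p ∣ 2 * h * P * P' := ((prime_dvd_coprimePrimorial_iff hp).1 hpd).2
    have hp2 : p ≠ 2 := by
      rintro rfl
      exact h2 (by simp [mul_assoc])
    have h3 : (2 : ℝ) < p := by exact_mod_cast lt_of_le_of_ne hp.two_le hp2.symm
    rw [divisorDensity_prime hp, div_lt_one (by linarith)]
    exact h3

theorem injective_mul_add {h : ℕ} : Function.Injective fun n : ℕ => n * (n + h) := by
  intro a b hab
  simp only at hab
  rcases lt_trichotomy a b with hlt | rfl | hlt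
  · nlinarith
  · rfl
  · nlinarith

theorem abs_rem_shiftSieve_le {P P' h : ℕ} (hP : 0 < P) (hP' : 0 < P') (hgcd : P.gcd P' ∣ h)
    (W A N : ℕ) {d : ℕ} (hd : d ∣ coprimePrimorial (2 * h * P * P') W) :
    |(shiftSieve P P' h W A N).rem d| ≤ d.divisors.card := by
  have hsq : Squarefree d := (squarefree_coprimePrimorial _ _).squarefree_of_dvd hd
  have hd0 : d ≠ 0 := hsq.ne_zero
  have hcop := coprime_of_dvd_coprimePrimorial hd
  have hcP' : d.Coprime P' := hcop.coprime_dvd_right (dvd_mul_left _ _)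
  have hcP : d.Coprime P := hcop.coprime_dvd_right ⟨2 * h * P', by ring⟩
  have hch : d.Coprime h := hcop.coprime_dvd_right ⟨2 * P * P', by ring⟩
  set I := Ico A (A + N)
  have hmult : BoundingSieve.multSum (s := shiftSieve P P' h W A N) d =
      ((I.filter fun n => (P ∣ n ∧ P' ∣ n + h) ∧ d ∣ n * (n + h)).card : ℝ) := by
    simp only [BoundingSieve.multSum, shiftSieve]
    rw [sum_image (fun a _ b _ hab => injective_mul_add hab), ← sum_filter, filter_filter]
    simp [I]
  have hfib : (I.filter fun n => (P ∣ n ∧ P' ∣ n + h) ∧ d ∣ n * (n + h)).card =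
      ∑ e ∈ d.divisors, (I.filter fun n => P * e ∣ n ∧ P' * (d / e) ∣ n + h).card := by
    rw [card_eq_sum_card_fiberwise (f := fun n => d.gcd n) (t := d.divisors)
      (fun n _ => by simp [hd0, Nat.gcd_dvd_left])]
    refine sum_congr rfl fun e he => ?_
    have hed := Nat.dvd_of_mem_divisors he
    rw [filter_filter]
    congr 1
    refine filter_congr fun n _ => ?_
    constructor
    · rintro ⟨⟨⟨h1, h2⟩, h3⟩, rfl⟩
      have h4 := div_gcd_dvd_add hd0 h3
      exact ⟨(hcP.coprime_dvd_left hed).symm.mul_dvd_of_dvd_of_dvd h1 (Nat.gcd_dvd_right d n),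
        (hcP'.coprime_dvd_left (Nat.div_dvd_of_dvd hed)).symm.mul_dvd_of_dvd_of_dvd h2 h4⟩
    · rintro ⟨h1, h2⟩
      have h3 : e ∣ n := (dvd_mul_left _ _).trans h1
      have h4 : d / e ∣ n + h := (dvd_mul_left _ _).trans h2
      refine ⟨⟨⟨(dvd_mul_right _ _).trans h1, (dvd_mul_right _ _).trans h2⟩, ?_⟩,
        gcd_eq_of_dvd_mul_add hd0 hch hed h3 h4⟩
      rw [← Nat.mul_div_cancel' hed]
      exact mul_dvd_mul h3 h4
  have hmain : BoundingSieve.multSum (s := shiftSieve P P' h W A N) d -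
      (shiftSieve P P' h W A N).nu d * (shiftSieve P P' h W A N).totalMass =
      ∑ e ∈ d.divisors, (((I.filter fun n => P * e ∣ n ∧ P' * (d / e) ∣ n + h).card : ℝ) -
        N / ((P * e).lcm (P' * (d / e)) : ℕ)) := by
    rw [sum_sub_distrib, hmult, hfib]
    push_cast
    congr 1
    have : ∀ e ∈ d.divisors, (N : ℝ) / ((P * e).lcm (P' * (d / e)) : ℕ) =
        N / (((P.lcm P' : ℕ) : ℝ) * d) := by
      intro e he
      have hed := Nat.dvd_of_mem_divisors he
      have hce : e.Coprime (d / e) := by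
        rw [← Nat.mul_div_cancel' hed] at hsq
        exact Nat.coprime_of_squarefree_mul hsq
      rw [lcm_mul_mul_of_coprime hP hce (hcP'.coprime_dvd_left hed)
        (hcP.coprime_dvd_left (Nat.div_dvd_of_dvd hed)), Nat.mul_div_cancel' hed]
      push_cast; rfl
    rw [sum_congr rfl this, sum_const, nsmul_eq_mul]
    simp only [shiftSieve, divisorDensity_apply]
    rw [div_mul_div_comm, mul_div_assoc, mul_comm (d : ℝ)]
  rw [BoundingSieve.rem, hmain]
  refine (abs_sum_le_sum_abs _ _).trans ?_
  rw [card_eq_sum_ones]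
  push_cast
  refine sum_le_sum fun e he => ?_
  have hed := Nat.dvd_of_mem_divisors he
  have hce : e.Coprime (d / e) := by
    rw [← Nat.mul_div_cancel' hed] at hsq
    exact Nat.coprime_of_squarefree_mul hsq
  refine abs_card_Ico_filter_dvd_dvd_add_sub_le A N h
    (Nat.mul_pos hP (Nat.pos_of_mem_divisors he))
    (Nat.mul_pos hP' (Nat.div_pos (Nat.divisor_le he) (Nat.pos_of_mem_divisors he))) ?_
  rw [gcd_mul_mul_of_coprime hce (hcP'.coprime_dvd_left hed)
    (hcP.coprime_dvd_left (Nat.div_dvd_of_dvd hed))]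
  exact hgcd

theorem card_sifted_le_selberg {P P' h : ℕ} (hP : 0 < P) (hP' : 0 < P') (hgcd : P.gcd P' ∣ h)
    (W A N : ℕ) {D : ℕ} (hD : 1 ≤ D) :
    (((Ico A (A + N)).filter fun n => (P ∣ n ∧ P' ∣ n + h) ∧
      (coprimePrimorial (2 * h * P * P') W).Coprime (n * (n + h))).card : ℝ) ≤
      N / (P.lcm P' : ℕ) / (shiftSieve P P' h W A N).selbergDenom D + (D : ℝ) ^ 4 := by
  have hsift := BoundingSieve.siftedSum_le_selberg (s := shiftSieve P P' h W A N) hD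
  have hleft : BoundingSieve.siftedSum (s := shiftSieve P P' h W A N) =
      (((Ico A (A + N)).filter fun n => (P ∣ n ∧ P' ∣ n + h) ∧
      (coprimePrimorial (2 * h * P * P') W).Coprime (n * (n + h))).card : ℝ) := by
    change (∑ m ∈ ((Ico A (A + N)).filter fun n => P ∣ n ∧ P' ∣ n + h).image
      fun n => n * (n + h), if (coprimePrimorial (2 * h * P * P') W).Coprime m then (1 : ℝ)
        else 0) = _
    rw [sum_image (fun a _ b _ hab => injective_mul_add hab), ← sum_filter, filter_filter]
    simp
  rw [← hleft]
  refine hsift.trans (add_le_add le_rfl ?_)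
  set S := (shiftSieve P P' h W A N).prodPrimes.divisors.filter (· ≤ D) with hS
  have hcard : (S.card : ℝ) ≤ D := by
    have : S ⊆ Icc 1 D := fun d hd => by
      have hd' := mem_filter.1 hd
      exact mem_Icc.2 ⟨Nat.pos_of_mem_divisors hd'.1, hd'.2⟩
    have := card_le_card this
    simp only [Nat.card_Icc, Nat.add_sub_cancel] at this
    exact_mod_cast this
  have hterm : ∀ d₁ ∈ S, ∀ d₂ ∈ S, ((shiftSieve P P' h W A N).nu d₁)⁻¹ *
      ((shiftSieve P P' h W A N).nu d₂)⁻¹ *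
        |(shiftSieve P P' h W A N).rem (d₁.lcm d₂)| ≤ (D : ℝ) * D := by
    intro d₁ hd₁ d₂ hd₂
    have h₁ := mem_filter.1 hd₁
    have h₂ := mem_filter.1 hd₂
    have hr := abs_rem_shiftSieve_le hP hP' hgcd W A N
      (Nat.lcm_dvd (Nat.dvd_of_mem_divisors h₁.1) (Nat.dvd_of_mem_divisors h₂.1))
    have hpos₁ := Nat.pos_of_mem_divisors h₁.1
    have hpos₂ := Nat.pos_of_mem_divisors h₂.1
    have hτ : (d₁.lcm d₂).divisors.card ≤ d₁.divisors.card * d₂.divisors.card := by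
      calc _ ≤ (d₁ * d₂).divisors.card :=
            card_le_card (Nat.divisors_subset_of_dvd (Nat.mul_pos hpos₁ hpos₂).ne'
              (Nat.lcm_dvd_mul d₁ d₂))
        _ ≤ _ := by rw [Nat.divisors_mul]; exact card_mul_le
    have hc₁ : (0 : ℝ) < d₁.divisors.card := by
      exact_mod_cast card_pos.2 (Nat.nonempty_divisors.2 hpos₁.ne')
    have hc₂ : (0 : ℝ) < d₂.divisors.card := by
      exact_mod_cast card_pos.2 (Nat.nonempty_divisors.2 hpos₂.ne')
    have hle₁ : (d₁ : ℝ) ≤ D := by exact_mod_cast h₁.2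
    have hle₂ : (d₂ : ℝ) ≤ D := by exact_mod_cast h₂.2
    have hτ' : ((d₁.lcm d₂).divisors.card : ℝ) ≤ d₁.divisors.card * d₂.divisors.card := by
      exact_mod_cast hτ
    change (divisorDensity d₁)⁻¹ * (divisorDensity d₂)⁻¹ * _ ≤ _
    rw [divisorDensity_apply, divisorDensity_apply, inv_div, inv_div]
    calc _ ≤ (d₁ : ℝ) / d₁.divisors.card * (d₂ / d₂.divisors.card) *
          (d₁.divisors.card * d₂.divisors.card) := by gcongr; exact hr.trans hτ'
      _ = (d₁ : ℝ) * d₂ := by field_simp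
      _ ≤ (D : ℝ) * D := by gcongr
  calc _ ≤ ∑ d₁ ∈ S, ∑ d₂ ∈ S, (D : ℝ) * D :=
        sum_le_sum fun d₁ hd₁ => sum_le_sum fun d₂ hd₂ => hterm d₁ hd₁ d₂ hd₂
    _ = (S.card : ℝ) * (S.card * (D * D)) := by simp only [sum_const, nsmul_eq_mul]
    _ ≤ (D : ℝ) * (D * (D * D)) := by gcongr
    _ = (D : ℝ) ^ 4 := by ring

theorem sum_le_sum_of_subset_image {ι κ : Type*} {s : Finset κ} {t : Finset ι}
    {f : κ → ℝ} {g : ι → ℝ} {φ : ι → κ} (hφ : ∀ k ∈ s, ∃ i ∈ t, φ i = k)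
    (hfg : ∀ i ∈ t, φ i ∈ s → f (φ i) ≤ g i) (hg : ∀ i ∈ t, 0 ≤ g i) :
    ∑ k ∈ s, f k ≤ ∑ i ∈ t, g i := by
  rcases s.eq_empty_or_nonempty with rfl | ⟨k₀, hk₀⟩
  · simpa using sum_nonneg hg
  have : Nonempty ι := ⟨(hφ k₀ hk₀).choose⟩
  choose! ψ hψt hψ using hφ
  have hinj : Set.InjOn ψ s := fun a ha b hb hab => by rw [← hψ a ha, ← hψ b hb, hab]
  calc ∑ k ∈ s, f k ≤ ∑ k ∈ s, g (ψ k) := sum_le_sum fun k hk => by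
        have := hfg (ψ k) (hψt k hk) (by rw [hψ k hk]; exact hk)
        rwa [hψ k hk] at this
    _ = ∑ i ∈ s.image ψ, g i := (sum_image hinj).symm
    _ ≤ ∑ i ∈ t, g i := sum_le_sum_of_subset_of_nonneg
        (image_subset_iff.2 hψt) fun i hi _ => hg i hi

/-- The sum of the reciprocals of the divisors of `n`. -/
noncomputable def sumInvDivisors (n : ℕ) : ℝ := ∑ d ∈ n.divisors, (d : ℝ)⁻¹

theorem sumInvDivisors_nonneg (n : ℕ) : 0 ≤ sumInvDivisors n := sum_nonneg fun _ _ => by positivity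

theorem sumInvDivisors_mul_le (m n : ℕ) :
    sumInvDivisors (m * n) ≤ sumInvDivisors m * sumInvDivisors n := by
  rw [sumInvDivisors, sumInvDivisors, sumInvDivisors, sum_mul_sum, ← sum_product']
  refine sum_le_sum_of_subset_image (φ := fun x : ℕ × ℕ => x.1 * x.2) ?_ ?_ ?_
  · intro k hk
    rw [Nat.divisors_mul] at hk
    obtain ⟨a, ha, b, hb, rfl⟩ := Finset.mem_mul.1 hk
    exact ⟨(a, b), mem_product.2 ⟨ha, hb⟩, rfl⟩
  · intro i _ _
    push_cast
    rw [mul_inv]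
  · intro i _
    positivity

theorem sumInvDivisors_prime_le {p : ℕ} (hp : p.Prime) : sumInvDivisors p ≤ 2 := by
  have : (p : ℝ)⁻¹ ≤ 1 := inv_le_one_of_one_le₀ (by exact_mod_cast hp.one_lt.le)
  rw [sumInvDivisors, hp.divisors, sum_pair hp.one_lt.ne]
  norm_num
  linarith

theorem sum_Ico_one_inv_sq_le (W : ℕ) : ∑ t ∈ Ico 1 W, ((t : ℝ) ^ 2)⁻¹ ≤ 2 := by
  have h := sum_Ioo_inv_sq_le (α := ℝ) 0 W
  have : Ico 1 W = Ioo 0 W := by ext; simp [Nat.succ_le_iff]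
  rw [this]
  simpa using h

theorem log_le_sum_Ico_inv {W : ℕ} (hW : 1 ≤ W) :
    Real.log W ≤ ∑ c ∈ Ico 1 W, (c : ℝ)⁻¹ := by
  obtain ⟨k, rfl⟩ : ∃ k, W = k + 1 := ⟨W - 1, by omega⟩
  refine (log_add_one_le_harmonic k).trans (le_of_eq ?_)
  rw [harmonic_eq_sum_Icc]
  push_cast
  rfl

/-- The squarefree integers below `W` which are coprime to `B`. -/
noncomputable def squarefreeCoprime (B W : ℕ) : Finset ℕ :=
  (Ico 1 W).filter fun a => Squarefree a ∧ a.Coprime B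

theorem mem_squarefreeCoprime {B W a : ℕ} :
    a ∈ squarefreeCoprime B W ↔ (1 ≤ a ∧ a < W) ∧ Squarefree a ∧ a.Coprime B := by
  simp [squarefreeCoprime]

theorem log_le_sum_squarefreeCoprime {B W : ℕ} (hB : B ≠ 0) (hW : 1 ≤ W) :
    Real.log W ≤ 2 * sumInvDivisors B * ∑ a ∈ squarefreeCoprime B W, (a : ℝ)⁻¹ := by
  set T := ∑ a ∈ squarefreeCoprime B W, (a : ℝ)⁻¹
  have hT : 0 ≤ T := sum_nonneg fun _ _ => by positivity
  calc Real.log W ≤ ∑ c ∈ Ico 1 W, (c : ℝ)⁻¹ := log_le_sum_Ico_inv hW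
    _ ≤ ∑ x ∈ (Ico 1 W ×ˢ B.divisors) ×ˢ squarefreeCoprime B W,
        ((x.1.1 : ℝ) ^ 2)⁻¹ * (x.1.2 : ℝ)⁻¹ * (x.2 : ℝ)⁻¹ := by
        refine sum_le_sum_of_subset_image
          (φ := fun x : (ℕ × ℕ) × ℕ => x.1.1 ^ 2 * (x.1.2 * x.2)) ?_ ?_ ?_
        · intro c hc
          have hc' := mem_Ico.1 hc
          obtain ⟨e, t, htc, he⟩ := Nat.sq_mul_squarefree c
          have hc0 : 0 < c := hc'.1
          have ht0 : 0 < t := by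
            rcases Nat.eq_zero_or_pos t with rfl | h
            · simp at htc; omega
            · exact h
          have he0 : 0 < e := Nat.pos_of_ne_zero he.ne_zero
          have htc' : t ≤ c := by
            rw [← htc, sq, mul_assoc]
            exact Nat.le_mul_of_pos_right _ (by positivity)
          have hec : e ≤ c := by rw [← htc]; exact Nat.le_mul_of_pos_left _ (by positivity)
          have hg0 : 0 < e.gcd B := Nat.gcd_pos_of_pos_left _ he0
          have hmul : e.gcd B * (e / e.gcd B) = e := Nat.mul_div_cancel' (Nat.gcd_dvd_left _ _)
          have hcop : (e.gcd B).Coprime (e / e.gcd B) :=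
            Nat.coprime_of_squarefree_mul (by rw [hmul]; exact he)
          refine ⟨((t, e.gcd B), e / e.gcd B), ?_, ?_⟩
          · simp only [mem_product, mem_Ico, Nat.mem_divisors, mem_squarefreeCoprime]
            refine ⟨⟨⟨ht0, by omega⟩, Nat.gcd_dvd_right _ _, hB⟩,
              ⟨Nat.div_pos (Nat.le_of_dvd he0 (Nat.gcd_dvd_left _ _)) hg0,
                (Nat.div_le_self _ _).trans_lt (by omega)⟩,
              he.squarefree_of_dvd (Nat.div_dvd_of_dvd (Nat.gcd_dvd_left _ _)), ?_⟩
            refine Nat.coprime_of_dvd fun p hp h1 h2 => ?_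
            have h3 : p ∣ e.gcd B :=
              Nat.dvd_gcd (h1.trans (Nat.div_dvd_of_dvd (Nat.gcd_dvd_left _ _))) h2
            exact hp.one_lt.ne' (Nat.eq_one_of_dvd_coprimes hcop h3 h1)
          · simp only [hmul, htc]
        · intro i _ _
          push_cast
          rw [mul_inv, mul_inv, mul_assoc]
        · intro i _
          positivity
    _ = (∑ t ∈ Ico 1 W, ((t : ℝ) ^ 2)⁻¹) * sumInvDivisors B * T := by
        rw [sumInvDivisors, sum_mul_sum, ← sum_product', sum_mul_sum, ← sum_product']
    _ ≤ 2 * sumInvDivisors B * T := by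
        have := sum_Ico_one_inv_sq_le W
        have := sumInvDivisors_nonneg B
        gcongr

theorem sum_sq_squarefreeCoprime_le (B W : ℕ) :
    (∑ a ∈ squarefreeCoprime B W, (a : ℝ)⁻¹) ^ 2 ≤
      2 * ∑ x ∈ (squarefreeCoprime B W ×ˢ squarefreeCoprime B W).filter
        (fun x => x.1.Coprime x.2), ((x.1 * x.2 : ℕ) : ℝ)⁻¹ := by
  set S := squarefreeCoprime B W with hS
  set U := (S ×ˢ S).filter (fun x => x.1.Coprime x.2) with hU
  have hU0 : 0 ≤ ∑ x ∈ U, ((x.1 * x.2 : ℕ) : ℝ)⁻¹ := sum_nonneg fun _ _ => by positivity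
  calc (∑ a ∈ S, (a : ℝ)⁻¹) ^ 2 = ∑ x ∈ S ×ˢ S, ((x.1 : ℝ)⁻¹ * (x.2 : ℝ)⁻¹) := by
        rw [sq, sum_mul_sum, ← sum_product']
    _ ≤ ∑ y ∈ Ico 1 W ×ˢ U, ((y.1 : ℝ) ^ 2)⁻¹ * ((y.2.1 * y.2.2 : ℕ) : ℝ)⁻¹ := by
        refine sum_le_sum_of_subset_image
          (φ := fun y : ℕ × (ℕ × ℕ) => (y.1 * y.2.1, y.1 * y.2.2)) ?_ ?_ ?_
        · rintro ⟨a, b⟩ hab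
          obtain ⟨ha, hb⟩ := mem_product.1 hab
          simp only [hS, mem_squarefreeCoprime] at ha hb
          have hg0 : 0 < a.gcd b := Nat.gcd_pos_of_pos_left _ ha.1.1
          have hga := Nat.gcd_dvd_left a b
          have hgb := Nat.gcd_dvd_right a b
          have hga' := Nat.le_of_dvd ha.1.1 hga
          have hgb' := Nat.le_of_dvd hb.1.1 hgb
          refine ⟨(a.gcd b, (a / a.gcd b, b / a.gcd b)), ?_, ?_⟩
          · simp only [hU, hS, mem_product, mem_filter, mem_Ico, mem_squarefreeCoprime]
            refine ⟨⟨hg0, by omega⟩, ⟨⟨⟨Nat.div_pos hga' hg0,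
                (Nat.div_le_self _ _).trans_lt ha.1.2⟩,
              ha.2.1.squarefree_of_dvd (Nat.div_dvd_of_dvd hga),
              ha.2.2.coprime_dvd_left (Nat.div_dvd_of_dvd hga)⟩,
              ⟨⟨Nat.div_pos hgb' hg0, (Nat.div_le_self _ _).trans_lt hb.1.2⟩,
              hb.2.1.squarefree_of_dvd (Nat.div_dvd_of_dvd hgb),
              hb.2.2.coprime_dvd_left (Nat.div_dvd_of_dvd hgb)⟩⟩,
              Nat.coprime_div_gcd_div_gcd hg0⟩
          · simp only [Nat.mul_div_cancel' hga, Nat.mul_div_cancel' hgb]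
        · intro i _ _
          simp only
          push_cast
          refine le_of_eq ?_
          rw [← mul_inv, ← mul_inv]
          ring
        · intro i _
          positivity
    _ = (∑ t ∈ Ico 1 W, ((t : ℝ) ^ 2)⁻¹) * ∑ x ∈ U, ((x.1 * x.2 : ℕ) : ℝ)⁻¹ := by
        rw [sum_mul_sum, ← sum_product']
    _ ≤ 2 * ∑ x ∈ U, ((x.1 * x.2 : ℕ) : ℝ)⁻¹ := by
        have := sum_Ico_one_inv_sq_le W
        gcongr

theorem sum_coprime_pairs_le (B W : ℕ) :
    ∑ x ∈ (squarefreeCoprime B W ×ˢ squarefreeCoprime B W).filter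
        (fun x => x.1.Coprime x.2), ((x.1 * x.2 : ℕ) : ℝ)⁻¹ ≤
      ∑ l ∈ (coprimePrimorial B W).divisors with l ≤ W ^ 2, divisorDensity l := by
  set T := (coprimePrimorial B W).divisors.filter (· ≤ W ^ 2) with hT
  rw [← sum_fiberwise_of_maps_to (t := T) (g := fun x : ℕ × ℕ => x.1 * x.2)]
  · refine sum_le_sum fun l hl => ?_
    have hl0 : l ≠ 0 := (Nat.pos_of_mem_divisors (mem_filter.1 hl).1).ne'
    have hcard : l.divisors.card = l.divisorsAntidiagonal.card := by
      rw [← Nat.map_div_right_divisors, card_map]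
    rw [divisorDensity_apply, hcard, div_eq_mul_inv, ← nsmul_eq_mul,
      ← sum_const]
    refine (sum_le_sum (g := fun _ => (l : ℝ)⁻¹) fun x hx => ?_).trans
      (sum_le_sum_of_subset_of_nonneg (fun x hx => ?_) fun _ _ _ => by positivity)
    · rw [(mem_filter.1 hx).2]
    · exact Nat.mem_divisorsAntidiagonal.2 ⟨(mem_filter.1 hx).2, hl0⟩
  · rintro ⟨a, b⟩ hx
    simp only [mem_filter, mem_product, mem_squarefreeCoprime] at hx
    obtain ⟨⟨ha, hb⟩, hab⟩ := hx
    simp only [hT, mem_filter, Nat.mem_divisors]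
    refine ⟨⟨dvd_coprimePrimorial ((Nat.squarefree_mul hab).2 ⟨ha.2.1, hb.2.1⟩)
      (ha.2.2.mul_left hb.2.2) fun p hp hpab => ?_, (squarefree_coprimePrimorial _ _).ne_zero⟩, ?_⟩
    · rcases (hp.dvd_mul).1 hpab with h | h
      · exact (Nat.le_of_dvd ha.1.1 h).trans_lt ha.1.2
      · exact (Nat.le_of_dvd hb.1.1 h).trans_lt hb.1.2
    · rw [sq]
      exact Nat.mul_le_mul ha.1.2.le hb.1.2.le

theorem BoundingSieve.nu_le_selbergTerms {s : BoundingSieve} {l : ℕ} (hl : l ∣ s.prodPrimes) :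
    s.nu l ≤ s.selbergTerms l := by
  rw [BoundingSieve.selbergTerms_apply]
  refine le_mul_of_one_le_right (BoundingSieve.nu_pos_of_dvd_prodPrimes hl).le ?_
  refine one_le_prod fun p hp => ?_
  have hp' := Nat.prime_of_mem_primeFactors hp
  have hpd := (Nat.dvd_of_mem_primeFactors hp).trans hl
  have h0 := s.nu_pos_of_prime p hp' hpd
  have h1 := s.nu_lt_one_of_prime p hp' hpd
  exact (one_le_inv₀ (by linarith)).2 (by linarith)

theorem log_sq_le_selbergDenom_shiftSieve {P P' h W A N : ℕ} (hB : 2 * h * P * P' ≠ 0)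
    (hW : 1 ≤ W) :
    Real.log W ^ 2 ≤ 8 * sumInvDivisors (2 * h * P * P') ^ 2 *
      (shiftSieve P P' h W A N).selbergDenom (W ^ 2) := by
  set B := 2 * h * P * P'
  have h1 := log_le_sum_squarefreeCoprime hB hW
  have h2 := sum_sq_squarefreeCoprime_le B W
  have h3 := sum_coprime_pairs_le B W
  have h4 : ∑ l ∈ (coprimePrimorial B W).divisors with l ≤ W ^ 2, divisorDensity l ≤
      (shiftSieve P P' h W A N).selbergDenom (W ^ 2) :=
    sum_le_sum fun l hl => BoundingSieve.nu_le_selbergTerms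
      (s := shiftSieve P P' h W A N) (Nat.dvd_of_mem_divisors (mem_filter.1 hl).1)
  have h0 : 0 ≤ Real.log W := Real.log_natCast_nonneg W
  calc Real.log W ^ 2 ≤ (2 * sumInvDivisors B * ∑ a ∈ squarefreeCoprime B W, (a : ℝ)⁻¹) ^ 2 := by
        gcongr
    _ = 4 * sumInvDivisors B ^ 2 * (∑ a ∈ squarefreeCoprime B W, (a : ℝ)⁻¹) ^ 2 := by ring
    _ ≤ 4 * sumInvDivisors B ^ 2 * (2 * (shiftSieve P P' h W A N).selbergDenom (W ^ 2)) := by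
        gcongr
        linarith
    _ = _ := by ring

theorem card_sifted_le {P P' h : ℕ} (hP : 0 < P) (hP' : 0 < P') (hh : 0 < h)
    (hgcd : P.gcd P' ∣ h) {W : ℕ} (hW : 2 ≤ W) (A N : ℕ) :
    (((Ico A (A + N)).filter fun n => (P ∣ n ∧ P' ∣ n + h) ∧
      ∀ q : ℕ, q.Prime → q < W → ¬ q ∣ 2 * h * P * P' → ¬ q ∣ n * (n + h)).card : ℝ) ≤
      8 * sumInvDivisors (2 * h * P * P') ^ 2 * N / ((P.lcm P' : ℕ) * Real.log W ^ 2)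
        + (W : ℝ) ^ 8 := by
  have hB : 2 * h * P * P' ≠ 0 := by positivity
  have h1 := card_sifted_le_selberg hP hP' hgcd W A N (D := W ^ 2) (Nat.one_le_pow _ _ (by omega))
  have h2 := log_sq_le_selbergDenom_shiftSieve (A := A) (N := N) hB (show 1 ≤ W by omega)
  have hlog : 0 < Real.log W := Real.log_pos (by exact_mod_cast hW)
  have hS := BoundingSieve.selbergDenom_pos (s := shiftSieve P P' h W A N) (D := W ^ 2)
    (Nat.one_le_pow _ _ (by omega))
  have hlcm : (0 : ℝ) < (P.lcm P' : ℕ) := by exact_mod_cast Nat.lcm_pos hP hP'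
  calc _ ≤ (((Ico A (A + N)).filter fun n => (P ∣ n ∧ P' ∣ n + h) ∧
      (coprimePrimorial (2 * h * P * P') W).Coprime (n * (n + h))).card : ℝ) := by
        refine Nat.cast_le.2 (card_le_card fun n hn => ?_)
        simp only [mem_filter] at hn ⊢
        refine ⟨hn.1, hn.2.1, Nat.coprime_of_dvd fun p hp hp1 hp2 => ?_⟩
        have := (prime_dvd_coprimePrimorial_iff hp).1 hp1
        exact hn.2.2 p hp this.1 this.2 hp2
    _ ≤ _ := h1
    _ ≤ _ := by
        refine add_le_add ?_ (by push_cast; rw [← pow_mul])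
        rw [div_div, div_le_div_iff₀ (by positivity) (by positivity)]
        calc (N : ℝ) * ((P.lcm P' : ℕ) * Real.log W ^ 2)
            ≤ N * ((P.lcm P' : ℕ) * (8 * sumInvDivisors (2 * h * P * P') ^ 2 *
              (shiftSieve P P' h W A N).selbergDenom (W ^ 2))) := by gcongr
          _ = _ := by ring

theorem summable_inv_mul_sqrt : Summable fun d : ℕ => ((d : ℝ) * √d)⁻¹ := by
  have h := (Real.summable_nat_rpow_inv (p := 3 / 2)).2 (by norm_num)
  refine h.congr fun d => ?_
  rw [Real.sqrt_eq_rpow, inv_inj]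
  rcases Nat.eq_zero_or_pos d with rfl | hd
  · rw [Nat.cast_zero, Real.zero_rpow (by norm_num), zero_mul]
  · have : (0 : ℝ) < d := by exact_mod_cast hd
    rw [← Real.rpow_one_add' this.le (by norm_num)]
    norm_num

theorem sqrt_mul_sqrt_le_lcm {d e : ℕ} (hd : 0 < d) (he : 0 < e) :
    √(d : ℝ) * √e ≤ (d.lcm e : ℕ) := by
  rw [← Real.sqrt_mul (by positivity)]
  refine Real.sqrt_le_iff.2 ⟨by positivity, ?_⟩
  have h1 : d ≤ d.lcm e := Nat.le_of_dvd (Nat.lcm_pos hd he) (Nat.dvd_lcm_left d e)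
  have h2 : e ≤ d.lcm e := Nat.le_of_dvd (Nat.lcm_pos hd he) (Nat.dvd_lcm_right d e)
  rw [sq]
  exact_mod_cast Nat.mul_le_mul h1 h2

theorem exists_sum_sumInvDivisors_sq_le :
    ∃ C : ℝ, 0 < C ∧ ∀ M : ℕ, ∑ n ∈ Icc 1 M, sumInvDivisors n ^ 2 ≤ C * M := by
  refine ⟨(∑' d : ℕ, ((d : ℝ) * √d)⁻¹) ^ 2 + 1, by positivity, fun M => ?_⟩
  set f : ℕ → ℝ := fun d => ((d : ℝ) * √d)⁻¹
  have h1 : ∀ n ∈ Icc 1 M, sumInvDivisors n ^ 2 = ∑ d ∈ Icc 1 M, ∑ e ∈ Icc 1 M,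
      if d.lcm e ∣ n then (d : ℝ)⁻¹ * (e : ℝ)⁻¹ else 0 := by
    intro n hn
    have hn' := mem_Icc.1 hn
    have hdiv : n.divisors = (Icc 1 M).filter (· ∣ n) := by
      ext d
      simp only [Nat.mem_divisors, mem_filter, mem_Icc]
      constructor
      · rintro ⟨h, h0⟩
        exact ⟨⟨Nat.pos_of_dvd_of_pos h (by omega), (Nat.le_of_dvd (by omega) h).trans hn'.2⟩, h⟩
      · rintro ⟨-, h⟩
        exact ⟨h, by omega⟩
    rw [sq, sumInvDivisors, sum_mul_sum, hdiv, sum_filter]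
    refine sum_congr rfl fun d _ => ?_
    rw [sum_filter]
    simp only [Nat.lcm_dvd_iff]
    by_cases hd : d ∣ n <;> simp [hd]
  rw [sum_congr rfl h1, sum_comm]
  have h2 : ∀ d ∈ Icc 1 M, (∑ n ∈ Icc 1 M, ∑ e ∈ Icc 1 M,
      if d.lcm e ∣ n then (d : ℝ)⁻¹ * (e : ℝ)⁻¹ else 0) ≤ ∑ e ∈ Icc 1 M, M * (f d * f e) := by
    intro d hd
    rw [sum_comm]
    refine sum_le_sum fun e he => ?_
    have hd0 : 0 < d := (mem_Icc.1 hd).1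
    have he0 : 0 < e := (mem_Icc.1 he).1
    have hl0 := Nat.lcm_pos hd0 he0
    have hcard : ((Icc 1 M).filter (d.lcm e ∣ ·)).card = M / d.lcm e := by
      have : Icc 1 M = Ioc 0 M := by ext; simp [Nat.succ_le_iff]
      rw [this, Nat.Ioc_filter_dvd_card_eq_div]
    have hsd : (0 : ℝ) < √d := Real.sqrt_pos.2 (by exact_mod_cast hd0)
    have hse : (0 : ℝ) < √e := Real.sqrt_pos.2 (by exact_mod_cast he0)
    have hd1 : (0 : ℝ) < d := by exact_mod_cast hd0
    have he1 : (0 : ℝ) < e := by exact_mod_cast he0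
    rw [← sum_filter, sum_const, nsmul_eq_mul, hcard]
    calc ((M / d.lcm e : ℕ) : ℝ) * ((d : ℝ)⁻¹ * (e : ℝ)⁻¹)
        ≤ ((M : ℝ) / (d.lcm e : ℕ)) * ((d : ℝ)⁻¹ * (e : ℝ)⁻¹) := by
          gcongr; exact Nat.cast_div_le
      _ ≤ ((M : ℝ) / (√d * √e)) * ((d : ℝ)⁻¹ * (e : ℝ)⁻¹) := by
          gcongr; exact sqrt_mul_sqrt_le_lcm hd0 he0
      _ = M * (f d * f e) := by simp only [f]; field_simp
  refine (sum_le_sum h2).trans ?_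
  have h3 : ∑ d ∈ Icc 1 M, f d ≤ ∑' d, f d :=
    summable_inv_mul_sqrt.sum_le_tsum _ fun _ _ => by positivity
  have h4 : 0 ≤ ∑ d ∈ Icc 1 M, f d := sum_nonneg fun _ _ => by positivity
  calc ∑ d ∈ Icc 1 M, ∑ e ∈ Icc 1 M, M * (f d * f e) = (∑ d ∈ Icc 1 M, f d) ^ 2 * M := by
        rw [sq, sum_mul_sum, sum_mul]
        refine sum_congr rfl fun d _ => ?_
        rw [sum_mul]
        refine sum_congr rfl fun e _ => ?_
        ring
    _ ≤ ((∑' d, f d) ^ 2 + 1) * M := by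
        gcongr
        nlinarith [pow_le_pow_left₀ h4 h3 2]

theorem sum_multiples_sumInvDivisors_sq_le {C : ℝ}
    (hC : ∀ M : ℕ, ∑ n ∈ Icc 1 M, sumInvDivisors n ^ 2 ≤ C * M) (hC0 : 0 < C) {g : ℕ}
    (hg : 0 < g) (M : ℕ) :
    ∑ h ∈ (Icc 1 M).filter (g ∣ ·), sumInvDivisors h ^ 2 ≤ sumInvDivisors g ^ 2 * C * M / g := by
  have h1 : ∑ h ∈ (Icc 1 M).filter (g ∣ ·), sumInvDivisors h ^ 2 ≤
      ∑ k ∈ Icc 1 (M / g), (sumInvDivisors g ^ 2 * sumInvDivisors k ^ 2) := by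
    refine sum_le_sum_of_subset_image (φ := fun k => g * k) ?_ ?_ ?_
    · intro h hh
      obtain ⟨hh1, k, rfl⟩ := mem_filter.1 hh
      have := mem_Icc.1 hh1
      refine ⟨k, mem_Icc.2 ⟨Nat.pos_of_ne_zero ?_, ?_⟩, rfl⟩
      · rintro rfl
        simp at this
      · rw [Nat.le_div_iff_mul_le hg, mul_comm]
        exact this.2
    · intro k _ _
      rw [← mul_pow]
      have := sumInvDivisors_nonneg (g * k)
      have := sumInvDivisors_mul_le g k
      gcongr
    · intro k _
      positivity
  refine h1.trans ?_
  rw [← mul_sum]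
  calc _ ≤ sumInvDivisors g ^ 2 * (C * (M / g : ℕ)) := by gcongr; exact hC _
    _ ≤ sumInvDivisors g ^ 2 * (C * (M / g)) := by gcongr; exact Nat.cast_div_le
    _ = _ := by ring

theorem prod_prime_pow_div_dvd_factorial (N : ℕ) :
    ∏ p ∈ (Icc 1 N).filter Nat.Prime, p ^ (N / p) ∣ N.factorial := by
  refine Finset.prod_dvd_of_isRelPrime (fun p hp q hq hpq => ?_) fun p hp => ?_
  · simp only [coe_filter, Set.mem_ofPred_eq] at hp hq
    exact Nat.coprime_iff_isRelPrime.1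
      (Nat.Coprime.pow _ _ ((Nat.coprime_primes hp.2 hq.2).2 hpq))
  · have hp' := (mem_filter.1 hp).2
    rw [hp'.pow_dvd_factorial_iff (b := Nat.log p N + 2) (by omega)]
    have := single_le_sum (f := fun i => N / p ^ i) (s := Ico 1 (Nat.log p N + 2))
      (fun _ _ => Nat.zero_le _) (mem_Ico.2 ⟨le_rfl, by omega⟩)
    simpa using this

theorem sum_log_div_prime_le (N : ℕ) :
    ∑ p ∈ (Icc 1 N).filter Nat.Prime, Real.log p / p ≤ 2 * Real.log N := by
  rcases Nat.eq_zero_or_pos N with rfl | hN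
  · simp
  have hN' : (0 : ℝ) < N := by exact_mod_cast hN
  have h1 : ∑ p ∈ (Icc 1 N).filter Nat.Prime, ((N / p : ℕ) : ℝ) * Real.log p ≤
      N * Real.log N := by
    have h2 : ∏ p ∈ (Icc 1 N).filter Nat.Prime, p ^ (N / p) ≤ N ^ N :=
      (Nat.le_of_dvd N.factorial_pos (prod_prime_pow_div_dvd_factorial N)).trans
        (Nat.factorial_le_pow N)
    have h3 : (∏ p ∈ (Icc 1 N).filter Nat.Prime, (p : ℝ) ^ (N / p)) ≤ (N : ℝ) ^ N := by
      exact_mod_cast h2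
    have h4 : ∀ p ∈ (Icc 1 N).filter Nat.Prime, (p : ℝ) ^ (N / p) ≠ 0 := fun p hp =>
      pow_ne_zero _ (by exact_mod_cast (mem_filter.1 hp).2.ne_zero)
    have h5 := Real.log_le_log (prod_pos fun p hp => lt_of_le_of_ne (by positivity)
      (h4 p hp).symm) h3
    rw [Real.log_prod h4, Real.log_pow] at h5
    simpa only [Real.log_pow] using h5
  have h6 : ∀ p ∈ (Icc 1 N).filter Nat.Prime,
      (N : ℝ) * (Real.log p / p) ≤ 2 * (((N / p : ℕ) : ℝ) * Real.log p) := by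
    intro p hp
    have hp0 : 0 < p := (mem_filter.1 hp).2.pos
    have hpN : p ≤ N := (mem_Icc.1 (mem_filter.1 hp).1).2
    have hp1 : (0 : ℝ) < p := by exact_mod_cast hp0
    have hk : 1 ≤ N / p := Nat.div_pos hpN hp0
    have hN2 : N ≤ 2 * (N / p) * p := by
      have := Nat.div_add_mod N p
      have := Nat.mod_lt N hp0
      nlinarith
    have hN3 : (N : ℝ) ≤ 2 * ((N / p : ℕ) : ℝ) * p := by exact_mod_cast hN2
    have hlog := Real.log_natCast_nonneg p
    calc (N : ℝ) * (Real.log p / p) ≤ (2 * ((N / p : ℕ) : ℝ) * p) * (Real.log p / p) := by gcongr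
      _ = _ := by field_simp
  have h7 := sum_le_sum h6
  rw [← mul_sum, ← mul_sum] at h7
  refine le_of_mul_le_mul_left ?_ hN'
  linarith

/-- The primes in the interval `[Z, Z ^ 2]`. -/
noncomputable def primesToSquare (Z : ℝ) : Finset ℕ :=
  (Icc 1 ⌊Z ^ 2⌋₊).filter fun p => p.Prime ∧ Z ≤ p

theorem mem_primesToSquare {Z : ℝ} {p : ℕ} :
    p ∈ primesToSquare Z ↔ p.Prime ∧ Z ≤ p ∧ (p : ℝ) ≤ Z ^ 2 := by
  simp only [primesToSquare, mem_filter, mem_Icc]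
  constructor
  · rintro ⟨⟨h1, h2⟩, h3, h4⟩
    exact ⟨h3, h4, (Nat.le_floor_iff (by positivity)).1 h2⟩
  · rintro ⟨h1, h2, h3⟩
    exact ⟨⟨h1.pos, Nat.le_floor h3⟩, h1, h2⟩

theorem sum_inv_primesToSquare_le {Z : ℝ} (hZ : 1 ≤ Z) :
    ∑ p ∈ primesToSquare Z, (p : ℝ)⁻¹ ≤ 4 := by
  rcases hZ.eq_or_lt with rfl | hZ1
  · have : primesToSquare 1 = ∅ := by
      refine eq_empty_of_forall_notMem fun p hp => ?_
      obtain ⟨h1, -, h2⟩ := mem_primesToSquare.1 hp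
      have : p ≤ 1 := by exact_mod_cast (by simpa using h2 : (p : ℝ) ≤ 1)
      exact absurd h1.one_lt (by omega)
    simp [this]
  have hlogZ := Real.log_pos hZ1
  have h1 : ∑ p ∈ primesToSquare Z, Real.log Z * (p : ℝ)⁻¹ ≤
      ∑ p ∈ (Icc 1 ⌊Z ^ 2⌋₊).filter Nat.Prime, Real.log p / p := by
    refine (sum_le_sum (g := fun p : ℕ => Real.log p / p) fun p hp => ?_).trans
      (sum_le_sum_of_subset_of_nonneg (fun p hp => ?_) fun p _ _ => ?_)
    · rw [div_eq_mul_inv]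
      have := (mem_primesToSquare.1 hp).2.1
      gcongr
    · have := mem_filter.1 hp
      exact mem_filter.2 ⟨this.1, this.2.1⟩
    · have := Real.log_natCast_nonneg p
      positivity
  have h2 := sum_log_div_prime_le ⌊Z ^ 2⌋₊
  have h3 : Real.log (⌊Z ^ 2⌋₊ : ℝ) ≤ 2 * Real.log Z := by
    have hpos : (0 : ℝ) < ⌊Z ^ 2⌋₊ := by
      exact_mod_cast Nat.floor_pos.2 (by nlinarith)
    calc _ ≤ Real.log (Z ^ 2) := Real.log_le_log hpos (Nat.floor_le (by positivity))
      _ = _ := by rw [Real.log_pow]; norm_num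
  rw [← mul_sum] at h1
  refine le_of_mul_le_mul_left ?_ hlogZ
  linarith

theorem exists_finset_prime_products (J : Finset ℕ) {Z : ℕ → ℝ} {V : ℝ}
    (hZ : ∀ i ∈ J, 1 ≤ Z i) (hZV : ∀ i ∈ J, Z i ≤ V) :
    ∃ Ps : Finset ℕ,
      (∀ p : ℕ → ℕ, (∀ i ∈ J, (p i).Prime ∧ Z i ≤ p i ∧ (p i : ℝ) ≤ Z i ^ 2) →
        ∏ i ∈ J, p i ∈ Ps) ∧
      (∀ P ∈ Ps, 0 < P ∧ (P : ℝ) ≤ (V ^ 2) ^ J.card ∧ sumInvDivisors P ≤ 2 ^ J.card) ∧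
      ∑ P ∈ Ps, (P : ℝ)⁻¹ ≤ 4 ^ J.card := by
  induction J using Finset.induction_on with
  | empty => exact ⟨{1}, by simp, by simp [sumInvDivisors], by simp⟩
  | insert j J hj ih =>
    obtain ⟨Ps, h1, h2, h3⟩ := ih (fun i hi => hZ i (mem_insert_of_mem hi))
      (fun i hi => hZV i (mem_insert_of_mem hi))
    have hZj := hZ j (mem_insert_self j J)
    have hZVj := hZV j (mem_insert_self j J)
    refine ⟨(primesToSquare (Z j) ×ˢ Ps).image fun x => x.1 * x.2, ?_, ?_, ?_⟩
    · intro p hp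
      rw [prod_insert hj]
      exact mem_image.2 ⟨(p j, ∏ i ∈ J, p i), mem_product.2
        ⟨mem_primesToSquare.2 (hp j (mem_insert_self j J)),
          h1 p fun i hi => hp i (mem_insert_of_mem hi)⟩, rfl⟩
    · intro P hP
      obtain ⟨⟨p, P₀⟩, hx, rfl⟩ := mem_image.1 hP
      obtain ⟨hp, hP₀⟩ := mem_product.1 hx
      obtain ⟨hp1, -, hp3⟩ := mem_primesToSquare.1 hp
      obtain ⟨g1, g2, g3⟩ := h2 P₀ hP₀
      simp only at g1 g2 g3 hp1 hp3 ⊢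
      rw [card_insert_of_notMem hj, pow_succ' (V ^ 2), pow_succ' (2 : ℝ)]
      refine ⟨Nat.mul_pos hp1.pos g1, ?_, ?_⟩
      · push_cast
        have : (p : ℝ) ≤ V ^ 2 := hp3.trans (by gcongr)
        gcongr
      · refine (sumInvDivisors_mul_le _ _).trans ?_
        have := sumInvDivisors_prime_le hp1
        have := sumInvDivisors_nonneg P₀
        gcongr
    · rw [card_insert_of_notMem hj, pow_succ']
      calc _ ≤ ∑ x ∈ primesToSquare (Z j) ×ˢ Ps, (x.1 : ℝ)⁻¹ * (x.2 : ℝ)⁻¹ := by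
            refine sum_le_sum_of_subset_image (φ := fun x : ℕ × ℕ => x.1 * x.2) ?_ ?_ ?_
            · intro k hk
              exact mem_image.1 hk
            · intro i _ _
              push_cast
              rw [mul_inv]
            · intro i _
              positivity
        _ = (∑ p ∈ primesToSquare (Z j), (p : ℝ)⁻¹) * ∑ P ∈ Ps, (P : ℝ)⁻¹ := by
            rw [sum_mul_sum, ← sum_product']
        _ ≤ 4 * 4 ^ J.card := by
            have := sum_inv_primesToSquare_le hZj
            have : 0 ≤ ∑ P ∈ Ps, (P : ℝ)⁻¹ := sum_nonneg fun _ _ => by positivity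
            gcongr

theorem sumInvDivisors_le_of_dvd {m n : ℕ} (hn : n ≠ 0) (h : m ∣ n) :
    sumInvDivisors m ≤ sumInvDivisors n :=
  sum_le_sum_of_subset_of_nonneg (Nat.divisors_subset_of_dvd hn h) fun _ _ _ => by positivity

theorem sum_card_dvd_pairs_le {C : ℝ} (hC0 : 0 < C)
    (hC : ∀ M : ℕ, ∑ n ∈ Icc 1 M, sumInvDivisors n ^ 2 ≤ C * M)
    {P P' : ℕ} (hP : 0 < P) (hP' : 0 < P') {R : ℝ} (hR : sumInvDivisors P ≤ R)
    (hR' : sumInvDivisors P' ≤ R) {W : ℕ} (hW : 2 ≤ W) (A N M : ℕ) :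
    ∑ h ∈ Icc 1 M, (((Ico A (A + N)).filter fun n =>
      (∃ m, n = P * m ∧ ∀ q, q.Prime → q < W → ¬ q ∣ m) ∧
        ∃ m, n + h = P' * m ∧ ∀ q, q.Prime → q < W → ¬ q ∣ m).card : ℝ) ≤
      32 * C * R ^ 6 * N * M / Real.log W ^ 2 * ((P : ℝ)⁻¹ * (P' : ℝ)⁻¹) + M * (W : ℝ) ^ 8 := by
  have hR0 : 0 ≤ R := (sumInvDivisors_nonneg P).trans hR
  have hlog : 0 < Real.log W := Real.log_pos (by exact_mod_cast hW)
  have hg : 0 < P.gcd P' := Nat.gcd_pos_of_pos_left _ hP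
  have hgR : sumInvDivisors (P.gcd P') ≤ R :=
    (sumInvDivisors_le_of_dvd hP.ne' (Nat.gcd_dvd_left _ _)).trans hR
  have hlcm : (0 : ℝ) < (P.lcm P' : ℕ) := by exact_mod_cast Nat.lcm_pos hP hP'
  have hterm : ∀ h ∈ Icc 1 M, (((Ico A (A + N)).filter fun n =>
      (∃ m, n = P * m ∧ ∀ q, q.Prime → q < W → ¬ q ∣ m) ∧
        ∃ m, n + h = P' * m ∧ ∀ q, q.Prime → q < W → ¬ q ∣ m).card : ℝ) ≤
      (if P.gcd P' ∣ h then 32 * R ^ 4 * N / ((P.lcm P' : ℕ) * Real.log W ^ 2) *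
        sumInvDivisors h ^ 2 else 0) + (W : ℝ) ^ 8 := by
    intro h hh
    split_ifs with hgcd
    · refine le_trans ?_ ((card_sifted_le hP hP' (mem_Icc.1 hh).1 hgcd hW A N).trans ?_)
      · refine Nat.cast_le.2 (card_le_card fun n hn => ?_)
        obtain ⟨hn, ⟨m, hm, hmq⟩, m', hm', hmq'⟩ := mem_filter.1 hn
        refine mem_filter.2 ⟨hn, ⟨⟨m, hm⟩, ⟨m', hm'⟩⟩, fun q hq hqW hqd hqn => ?_⟩
        rcases hq.dvd_mul.1 hqn with h1 | h1
        · rw [hm] at h1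
          rcases hq.dvd_mul.1 h1 with h2 | h2
          · exact hqd ((h2.mul_left (2 * h)).mul_right P')
          · exact hmq q hq hqW h2
        · rw [hm'] at h1
          rcases hq.dvd_mul.1 h1 with h2 | h2
          · exact hqd (h2.mul_left _)
          · exact hmq' q hq hqW h2
      · have h2 : sumInvDivisors (2 * h * P * P') ≤ 2 * sumInvDivisors h * R * R := by
          have h0 := sumInvDivisors_nonneg
          calc _ ≤ sumInvDivisors 2 * sumInvDivisors h * sumInvDivisors P * sumInvDivisors P' := by
                refine (sumInvDivisors_mul_le _ _).trans ?_
                refine mul_le_mul_of_nonneg_right ?_ (h0 _)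
                refine (sumInvDivisors_mul_le _ _).trans ?_
                exact mul_le_mul_of_nonneg_right (sumInvDivisors_mul_le _ _) (h0 _)
            _ ≤ _ := by
                have := sumInvDivisors_prime_le Nat.prime_two
                have := h0 2
                have := h0 h
                have := h0 P
                have := h0 P'
                gcongr
        have h3 := sumInvDivisors_nonneg (2 * h * P * P')
        gcongr
        calc _ ≤ 8 * (2 * sumInvDivisors h * R * R) ^ 2 * N /
              ((P.lcm P' : ℕ) * Real.log W ^ 2) := by
              gcongr
          _ = _ := by ring
    · rw [filter_false_of_mem]
      · simp
      · rintro n - ⟨⟨m, hm, -⟩, m', hm', -⟩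
        refine hgcd ?_
        have h1 : P.gcd P' ∣ n := hm ▸ (Nat.gcd_dvd_left _ _).mul_right m
        have h2 : P.gcd P' ∣ n + h := hm' ▸ (Nat.gcd_dvd_right _ _).mul_right m'
        exact (Nat.dvd_add_right h1).1 h2
  refine (sum_le_sum hterm).trans ?_
  rw [sum_add_distrib, ← sum_filter, ← mul_sum]
  simp only [sum_const, Nat.card_Icc, add_tsub_cancel_right, nsmul_eq_mul]
  refine add_le_add ?_ le_rfl
  have hs := sum_multiples_sumInvDivisors_sq_le hC hC0 hg M
  have hg' : (0 : ℝ) < (P.gcd P' : ℕ) := by exact_mod_cast hg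
  have hprod : ((P.gcd P' : ℕ) : ℝ) * (P.lcm P' : ℕ) = P * P' := by
    exact_mod_cast Nat.gcd_mul_lcm P P'
  have h0 := sumInvDivisors_nonneg (P.gcd P')
  have hP0 : (0 : ℝ) < P := by exact_mod_cast hP
  have hP0' : (0 : ℝ) < P' := by exact_mod_cast hP'
  calc _ ≤ 32 * R ^ 4 * N / ((P.lcm P' : ℕ) * Real.log W ^ 2) *
        (R ^ 2 * C * M / (P.gcd P' : ℕ)) := by
        refine mul_le_mul_of_nonneg_left (hs.trans ?_) (by positivity)
        gcongr
    _ = 32 * C * R ^ 6 * N * M / Real.log W ^ 2 * ((P.gcd P' : ℕ) * (P.lcm P' : ℕ) : ℝ)⁻¹ := by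
        field_simp
    _ = _ := by rw [hprod, mul_inv]

theorem sum_card_rough_pairs_le {C : ℝ} (hC0 : 0 < C)
    (hC : ∀ M : ℕ, ∑ n ∈ Icc 1 M, sumInvDivisors n ^ 2 ≤ C * M)
    {Ps : Finset ℕ} {R S : ℝ} (hPs : ∀ P ∈ Ps, 0 < P ∧ sumInvDivisors P ≤ R)
    (hS : ∑ P ∈ Ps, (P : ℝ)⁻¹ ≤ S) {W : ℕ} (hW : 2 ≤ W) {Q : Set ℕ}
    (hQ : ∀ n ∈ Q, ∃ P ∈ Ps, ∃ m, n = P * m ∧ ∀ q, q.Prime → q < W → ¬ q ∣ m) (A N M : ℕ) :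
    ∑ h ∈ Icc 1 M, (((Ico A (A + N)).filter fun n => n ∈ Q ∧ n + h ∈ Q).card : ℝ) ≤
      32 * C * R ^ 6 * S ^ 2 * N * M / Real.log W ^ 2 + M * (Ps.card : ℝ) ^ 2 * (W : ℝ) ^ 8 := by
  have hS0 : 0 ≤ ∑ P ∈ Ps, (P : ℝ)⁻¹ := sum_nonneg fun _ _ => by positivity
  calc _ ≤ ∑ h ∈ Icc 1 M, ∑ x ∈ Ps ×ˢ Ps, (((Ico A (A + N)).filter fun n =>
      (∃ m, n = x.1 * m ∧ ∀ q, q.Prime → q < W → ¬ q ∣ m) ∧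
        ∃ m, n + h = x.2 * m ∧ ∀ q, q.Prime → q < W → ¬ q ∣ m).card : ℝ) := by
        refine sum_le_sum fun h _ => ?_
        rw [← Nat.cast_sum]
        refine Nat.cast_le.2 (le_trans (card_le_card fun n hn => ?_) card_biUnion_le)
        obtain ⟨hn, h1, h2⟩ := mem_filter.1 hn
        obtain ⟨P, hP, hP1⟩ := hQ n h1
        obtain ⟨P', hP', hP1'⟩ := hQ _ h2
        exact mem_biUnion.2 ⟨(P, P'), mem_product.2 ⟨hP, hP'⟩, mem_filter.2 ⟨hn, hP1, hP1'⟩⟩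
    _ ≤ ∑ x ∈ Ps ×ˢ Ps, (32 * C * R ^ 6 * N * M / Real.log W ^ 2 *
          ((x.1 : ℝ)⁻¹ * (x.2 : ℝ)⁻¹) + M * (W : ℝ) ^ 8) := by
        rw [sum_comm]
        refine sum_le_sum fun x hx => ?_
        obtain ⟨hx1, hx2⟩ := mem_product.1 hx
        exact sum_card_dvd_pairs_le hC0 hC (hPs _ hx1).1 (hPs _ hx2).1 (hPs _ hx1).2
          (hPs _ hx2).2 hW A N M
    _ = 32 * C * R ^ 6 * N * M / Real.log W ^ 2 * (∑ P ∈ Ps, (P : ℝ)⁻¹) ^ 2 +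
          (Ps.card : ℝ) ^ 2 * (M * (W : ℝ) ^ 8) := by
        rw [sum_add_distrib, ← mul_sum, sq (∑ P ∈ Ps, (P : ℝ)⁻¹), sum_mul_sum, ← sum_product']
        simp [sq]
    _ ≤ 32 * C * R ^ 6 * N * M / Real.log W ^ 2 * S ^ 2 +
          (Ps.card : ℝ) ^ 2 * (M * (W : ℝ) ^ 8) := by gcongr
    _ = _ := by ring

theorem exists_finset_cover_sievedSet {r : ℕ} {Z : ℕ → ℝ} (hZ : ∀ i ∈ Icc 1 r, 1 ≤ Z i)
    {V : ℝ} (hV : 1 ≤ V) (X z : ℝ) :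
    ∃ Ps : Finset ℕ, (∀ P ∈ Ps, 0 < P ∧ sumInvDivisors P ≤ 2 ^ r) ∧
      ∑ P ∈ Ps, (P : ℝ)⁻¹ ≤ 4 ^ r ∧ (Ps.card : ℝ) ≤ V ^ (2 * r) ∧
      ∀ n ∈ sievedSet X r Z z, ∃ P ∈ Ps, ∃ m, n = P * m ∧
        ∀ q : ℕ, q.Prime → q < ⌈min z V⌉₊ → ¬ q ∣ m := by
  set J := (Icc 1 r).filter fun i => Z i ≤ V with hJ
  have hJr : J.card ≤ r := (card_filter_le _ _).trans (by simp)
  obtain ⟨Ps, h1, h2, h3⟩ := exists_finset_prime_products J (Z := Z) (V := V)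
    (fun i hi => hZ i (mem_filter.1 hi).1) fun i hi => (mem_filter.1 hi).2
  have hV2 : (V ^ 2) ^ J.card ≤ V ^ (2 * r) := by
    rw [← pow_mul]
    exact pow_le_pow_right₀ hV (by omega)
  refine ⟨Ps, fun P hP => ⟨(h2 P hP).1, (h2 P hP).2.2.trans
    (pow_le_pow_right₀ (by norm_num) hJr)⟩, h3.trans (pow_le_pow_right₀ (by norm_num) hJr), ?_, ?_⟩
  · have hsub : Ps ⊆ Icc 1 ⌊V ^ (2 * r)⌋₊ := fun P hP => mem_Icc.2
      ⟨(h2 P hP).1, Nat.le_floor ((h2 P hP).2.1.trans hV2)⟩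
    have := card_le_card hsub
    rw [Nat.card_Icc, add_tsub_cancel_right] at this
    exact (Nat.cast_le.2 this).trans (Nat.floor_le (by positivity))
  · rintro n ⟨-, p, m, hp, rfl, hm⟩
    refine ⟨_, h1 p fun i hi => hp i (mem_filter.1 hi).1,
      (∏ i ∈ (Icc 1 r).filter fun i => ¬ Z i ≤ V, p i) * m, ?_, ?_⟩
    · rw [← mul_assoc, prod_filter_mul_prod_filter_not]
    · intro q hq hqW hqm
      have hqW' := lt_min_iff.1 (Nat.lt_ceil.1 hqW)
      rcases hq.dvd_mul.1 hqm with h | h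
      · obtain ⟨i, hi, hqi⟩ := (Prime.dvd_finsetProd_iff hq.prime _).1 h
        obtain ⟨hi1, hi2⟩ := mem_filter.1 hi
        have heq := (Nat.prime_dvd_prime_iff_eq hq (hp i hi1).1).1 hqi
        have := (hp i hi1).2.1
        rw [← heq] at this
        linarith [hqW'.2]
      · exact hm q hq hqW'.1 h

theorem exists_sum_card_sievedSet_pairs_le (r : ℕ) :
    ∃ C : ℝ, 0 < C ∧ ∀ Z : ℕ → ℝ, (∀ i ∈ Icc 1 r, 1 ≤ Z i) → ∀ X z V : ℝ, 2 ≤ z → 2 ≤ V →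
      ∀ A N M : ℕ, ∑ h ∈ Icc 1 M, (((Ico A (A + N)).filter fun n =>
        n ∈ sievedSet X r Z z ∧ n + h ∈ sievedSet X r Z z).card : ℝ) ≤
        C * N * M / Real.log (min z V) ^ 2 + M * (V ^ (4 * r) * (2 * V) ^ 8) := by
  obtain ⟨C, hC0, hC⟩ := exists_sum_sumInvDivisors_sq_le
  refine ⟨32 * C * (2 ^ r) ^ 6 * (4 ^ r) ^ 2, by positivity, fun Z hZ X z V hz hV A N M => ?_⟩
  obtain ⟨Ps, h1, h2, h3, h4⟩ := exists_finset_cover_sievedSet hZ (one_le_two.trans hV) X z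
  have hw : 2 ≤ min z V := le_min hz hV
  have hW : 2 ≤ ⌈min z V⌉₊ := by
    have := hw.trans (Nat.le_ceil (min z V))
    exact_mod_cast this
  have hlog : 0 < Real.log (min z V) := Real.log_pos (by linarith)
  have hlogW : Real.log (min z V) ≤ Real.log (⌈min z V⌉₊ : ℝ) :=
    Real.log_le_log (by linarith) (Nat.le_ceil _)
  have hWV : (⌈min z V⌉₊ : ℝ) ≤ 2 * V := by
    have := Nat.ceil_lt_add_one (a := min z V) (by linarith)
    linarith [min_le_right z V]
  refine (sum_card_rough_pairs_le hC0 hC h1 h2 hW h4 A N M).trans ?_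
  rw [mul_assoc (M : ℝ)]
  have h5 : (Ps.card : ℝ) ^ 2 ≤ V ^ (4 * r) := by
    calc _ ≤ (V ^ (2 * r)) ^ 2 := by gcongr
      _ = _ := by rw [← pow_mul]; congr 1; ring
  gcongr

theorem card_sq_le_card_add_sum_pairs {F : Finset ℕ} {a M : ℕ} (hF : F ⊆ Icc a (a + M)) :
    F.card ^ 2 ≤ F.card + 2 * ∑ h ∈ Icc 1 M, (F.filter fun n => n + h ∈ F).card := by
  set G := fun h => F.filter fun n => n + h ∈ F
  have hsub : F.offDiag ⊆ (Icc 1 M).biUnion fun h =>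
      (G h).image (fun n => (n, n + h)) ∪ (G h).image fun n => (n + h, n) := by
    rintro ⟨x, y⟩ hxy
    obtain ⟨hx, hy, hne⟩ := mem_offDiag.1 hxy
    have hx' := mem_Icc.1 (hF hx)
    have hy' := mem_Icc.1 (hF hy)
    simp only at hx hy hne hx' hy'
    rcases lt_or_gt_of_ne hne with h | h
    · refine mem_biUnion.2 ⟨y - x, mem_Icc.2 (by omega), mem_union_left _ (mem_image.2
        ⟨x, mem_filter.2 ⟨hx, ?_⟩, ?_⟩)⟩
      · rwa [Nat.add_sub_cancel' h.le]
      · rw [Nat.add_sub_cancel' h.le]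
    · refine mem_biUnion.2 ⟨x - y, mem_Icc.2 (by omega), mem_union_right _ (mem_image.2
        ⟨y, mem_filter.2 ⟨hy, ?_⟩, ?_⟩)⟩
      · rwa [Nat.add_sub_cancel' h.le]
      · rw [Nat.add_sub_cancel' h.le]
  have h1 : F.offDiag.card ≤ 2 * ∑ h ∈ Icc 1 M, (G h).card := by
    refine (card_le_card hsub).trans (card_biUnion_le.trans ?_)
    rw [mul_sum]
    refine sum_le_sum fun h _ => (card_union_le _ _).trans ?_
    rw [two_mul]
    exact add_le_add card_image_le card_image_le
  rw [offDiag_card] at h1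
  change F.card ^ 2 ≤ F.card + 2 * ∑ h ∈ Icc 1 M, (G h).card
  rw [sq]
  omega

theorem eventually_log_growth (r : ℕ) (hr : 1 ≤ r) :
    ∃ X₀ : ℝ, ∀ X : ℝ, X₀ ≤ X → 2 ≤ Real.log X ∧
      2 ≤ Real.exp (Real.log X / Real.log (Real.log X) ^ 3) ∧
      Real.log X / Real.log (Real.log X) ^ 4 + 10 * Real.log (Real.log X) ≤ Real.log X / 10 ∧
      2 ≤ Real.exp (Real.log X / (100 * r)) ∧
      1024 * Real.log X ^ 2 ≤ Real.exp (Real.log X / 2) := by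
  have hr' : (0 : ℝ) < 100 * r := by
    have : (0 : ℝ) < r := by exact_mod_cast hr
    positivity
  have hexp := Real.tendsto_exp_atTop
  have key : ∀ᶠ L : ℝ in Filter.atTop, 2 ≤ L ∧ 2 ≤ Real.exp (L / Real.log L ^ 3) ∧
      L / Real.log L ^ 4 + 10 * Real.log L ≤ L / 10 ∧ 2 ≤ Real.exp (L / (100 * r)) ∧
      1024 * L ^ 2 ≤ Real.exp (L / 2) := by
    have e1 : ∀ᶠ L : ℝ in Filter.atTop, Real.log L ^ 3 ≤ L := by
      have := (Real.isLittleO_pow_log_id_atTop (n := 3)).bound one_pos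
      filter_upwards [this, Filter.eventually_ge_atTop 1] with L hL hL1
      have h2 := Real.log_nonneg hL1
      simpa [abs_of_nonneg h2, abs_of_nonneg (zero_le_one.trans hL1)] using hL
    have e2 : ∀ᶠ L : ℝ in Filter.atTop, Real.log L ≤ 1 / 200 * L := by
      have := (Real.isLittleO_log_id_atTop).bound (show (0 : ℝ) < 1 / 200 by norm_num)
      filter_upwards [this, Filter.eventually_ge_atTop 1] with L hL hL1
      have h2 := Real.log_nonneg hL1
      simpa [abs_of_nonneg h2, abs_of_nonneg (zero_le_one.trans hL1)] using hL
    have e3 : ∀ᶠ L : ℝ in Filter.atTop, 3 ≤ Real.log L :=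
      Real.tendsto_log_atTop.eventually_ge_atTop 3
    have e4 : ∀ᶠ L : ℝ in Filter.atTop, 2 ≤ Real.exp (L / (100 * r)) :=
      (hexp.comp (Filter.tendsto_id.atTop_div_const hr')).eventually_ge_atTop 2
    have e5 : ∀ᶠ L : ℝ in Filter.atTop, 4096 ≤ Real.exp (L / 2) / (L / 2) ^ 2 :=
      ((Real.tendsto_exp_div_pow_atTop 2).comp
        (Filter.tendsto_id.atTop_div_const two_pos)).eventually_ge_atTop 4096
    filter_upwards [e1, e2, e3, e4, e5, Filter.eventually_ge_atTop 2] with L h1 h2 h3 h4 h5 h6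
    refine ⟨h6, ?_, ?_, h4, ?_⟩
    · have : 1 ≤ L / Real.log L ^ 3 := by
        rw [le_div_iff₀ (by positivity)]
        linarith
      linarith [Real.add_one_le_exp (L / Real.log L ^ 3)]
    · have : L / Real.log L ^ 4 ≤ L / 20 := by
        gcongr
        calc (20 : ℝ) ≤ 3 ^ 4 := by norm_num
          _ ≤ _ := by gcongr
      linarith
    · rw [le_div_iff₀ (by positivity)] at h5
      linarith
  obtain ⟨X₀, hX₀⟩ := Filter.eventually_atTop.1 (Real.tendsto_log_atTop.eventually key)
  exact ⟨X₀, hX₀⟩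

theorem exists_sum_card_sievedSet_pairs_short_le (r : ℕ) (hr : 1 ≤ r) :
    ∃ C : ℝ, 0 < C ∧ ∃ X₀ : ℝ, ∀ X : ℝ, X₀ ≤ X →
    ∀ Z : ℕ → ℝ, (∀ i ∈ Icc 1 r, 1 ≤ Z i) →
    ∀ z : ℝ, Real.exp (Real.log X / Real.log (Real.log X) ^ 3) ≤ z → z ≤ 4 * X →
    ∀ Y H : ℝ, X / Real.exp (Real.log X / Real.log (Real.log X) ^ 4) ≤ Y →
      1 ≤ H → H ≤ Real.log X ^ 10 →
      0 < Y ∧ 0 < Real.log z ∧ Real.log z ≤ Y / H ∧ ∀ M : ℕ,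
      ∑ h ∈ Icc 1 M, (((Icc ⌈Y⌉₊ ⌊Y + Y / H⌋₊).filter fun n =>
        n ∈ sievedSet X r Z z ∧ n + h ∈ sievedSet X r Z z).card : ℝ) ≤
        C * (Y / H) / Real.log z ^ 2 * M := by
  obtain ⟨C, hC0, hC⟩ := exists_sum_card_sievedSet_pairs_le r
  obtain ⟨X₀, hX₀⟩ := eventually_log_growth r hr
  refine ⟨C * 2 * (200 * r) ^ 2 + 1, by positivity, max X₀ 1,
    fun X hX Z hZ z hz hzX Y H hXY hH1 hHX => ?_⟩
  obtain ⟨g1, g2, g3, g4, g5⟩ := hX₀ X ((le_max_left _ _).trans hX)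
  have hX0 : 0 < X := zero_lt_one.trans_le ((le_max_right _ _).trans hX)
  have hr0 : (0 : ℝ) < r := by exact_mod_cast hr
  have hr1 : (1 : ℝ) ≤ r := by exact_mod_cast hr
  set L := Real.log X with hL
  have hL0 : 0 < L := by linarith
  have hXL : Real.exp L = X := Real.exp_log hX0
  have hz2 : 2 ≤ z := g2.trans hz
  have hlz : 0 < Real.log z := Real.log_pos (by linarith)
  have hlzL : Real.log z ≤ 2 * L := by
    calc _ ≤ Real.log (X * X) := by
          refine Real.log_le_log (by linarith) (hzX.trans ?_)
          have : 4 ≤ X := by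
            have h1 := Real.add_one_le_exp (1 : ℝ)
            have h2 : Real.exp 2 = Real.exp 1 * Real.exp 1 := by
              rw [← Real.exp_add]; norm_num
            have h3 := Real.exp_le_exp.2 g1
            rw [hXL] at h3
            nlinarith
          gcongr
      _ = _ := by rw [Real.log_mul hX0.ne' hX0.ne']; ring
  have hH0 : 0 < H := by linarith
  have hHexp : H ≤ Real.exp (10 * Real.log L) := by
    refine hHX.trans_eq ?_
    rw [mul_comm, Real.exp_mul, Real.exp_log hL0]
    norm_cast
  have hYexp : Real.exp (L - L / Real.log L ^ 4) ≤ Y := by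
    rwa [Real.exp_sub, hXL]
  have hY0 : 0 < Y := (Real.exp_pos _).trans_le hYexp
  have hU : Real.exp (9 / 10 * L) ≤ Y / H := by
    calc _ ≤ Real.exp (L - L / Real.log L ^ 4 - 10 * Real.log L) :=
          Real.exp_le_exp.2 (by linarith)
      _ = Real.exp (L - L / Real.log L ^ 4) / Real.exp (10 * Real.log L) := Real.exp_sub _ _
      _ ≤ _ := by gcongr
  have hUpos : 0 < Y / H := by positivity
  have hU2 : 1024 * L ^ 2 ≤ Y / H :=
    (g5.trans (Real.exp_le_exp.2 (by linarith))).trans hU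
  refine ⟨hY0, hlz, by nlinarith, fun M => ?_⟩
  set V := Real.exp (L / (100 * r)) with hV
  have hN1 : ⌈Y⌉₊ ≤ ⌊Y + Y / H⌋₊ + 1 := by
    refine Nat.ceil_le.2 ?_
    push_cast
    linarith [Nat.lt_floor_add_one (Y + Y / H)]
  set N := ⌊Y + Y / H⌋₊ + 1 - ⌈Y⌉₊ with hN
  have hNU : (N : ℝ) ≤ 2 * (Y / H) := by
    rw [hN, Nat.cast_sub hN1]
    push_cast
    have := Nat.floor_le (a := Y + Y / H) (by positivity)
    nlinarith [Nat.le_ceil Y]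
  have hIcc : Icc ⌈Y⌉₊ ⌊Y + Y / H⌋₊ = Ico ⌈Y⌉₊ (⌈Y⌉₊ + N) := by
    ext n
    simp only [mem_Icc, mem_Ico]
    omega
  rw [hIcc]
  refine (hC Z hZ X z V hz2 g4 _ N M).trans ?_
  have hlogw : Real.log z / (200 * r) ≤ Real.log (min z V) := by
    rcases min_choice z V with h | h <;> rw [h]
    · exact div_le_self hlz.le (by linarith)
    · rw [hV, Real.log_exp, div_le_div_iff₀ (by positivity) (by positivity)]
      nlinarith
  have hmain : C * N * M / Real.log (min z V) ^ 2 ≤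
      C * (2 * (Y / H)) * M / (Real.log z / (200 * r)) ^ 2 := by gcongr
  have herr : V ^ (4 * r) * (2 * V) ^ 8 ≤ Y / H / Real.log z ^ 2 := by
    have h1 : V ^ (4 * r) = Real.exp (L / 25) := by
      rw [hV, ← Real.exp_nat_mul]
      congr 1
      push_cast
      field_simp
      ring
    have h2 : V ^ 8 ≤ Real.exp (8 * L / 100) := by
      rw [hV, ← Real.exp_nat_mul]
      refine Real.exp_le_exp.2 ?_
      push_cast
      rw [mul_div_assoc']
      gcongr
      linarith
    rw [le_div_iff₀ (by positivity)]
    calc _ = Real.exp (L / 25) * (256 * V ^ 8) * Real.log z ^ 2 := by rw [h1]; ring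
      _ ≤ Real.exp (L / 25) * (256 * Real.exp (8 * L / 100)) * (2 * L) ^ 2 := by gcongr
      _ = Real.exp (L / 25) * Real.exp (8 * L / 100) * (1024 * L ^ 2) := by ring
      _ ≤ Real.exp (L / 25) * Real.exp (8 * L / 100) * Real.exp (L / 2) := by gcongr
      _ = Real.exp (L / 25 + 8 * L / 100 + L / 2) := by rw [Real.exp_add, Real.exp_add]
      _ ≤ Real.exp (9 / 10 * L) := Real.exp_le_exp.2 (by linarith)
      _ ≤ _ := hU
  calc _ ≤ C * (2 * (Y / H)) * M / (Real.log z / (200 * r)) ^ 2 +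
        M * (Y / H / Real.log z ^ 2) := by gcongr
    _ = _ := by
      field_simp

end

/-- Lemma 15: bounds for the quantities `S₁(X,(a_n))` and `S₂(X,(a_n))` when the
coefficients are dominated by the indicator of the sieved set `Q`.  The maxima over
`X/X₁ ≤ Y ≤ 4X` and `1 ≤ H ≤ (log X)^{10}` are expressed by universally quantifying
over `Y` and `H` in those ranges. -/
theorem sieved_coefficients_S1_S2_bounds (r : ℕ) (hr : 1 ≤ r) :
    ∃ C : ℝ, 0 < C ∧ ∃ X₀ : ℝ, ∀ X : ℝ, X₀ ≤ X → ∀ T : ℝ, 1 ≤ T →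
    ∀ Z : ℕ → ℝ, (∀ i ∈ Finset.Icc 1 r, 1 ≤ Z i) →
      (∀ i j : ℕ, 1 ≤ i → i ≤ j → j ≤ r → Z i ≤ Z j) →
      Real.exp (Real.log X / Real.log (Real.log X) ^ 3) ≤ Z r →
    ∀ z : ℝ, Z r ≤ z → z ≤ 4 * X →
    ∀ a : ℕ → ℝ, (∀ n : ℕ, |a n| ≤ Set.indicator (sievedSet X r Z z) (fun _ => 1) n) →
    ∀ Y H : ℝ,
      X / Real.exp (Real.log X / Real.log (Real.log X) ^ 4) ≤ Y → Y ≤ 4 * X →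
      1 ≤ H → H ≤ Real.log X ^ 10 →
      H * (∑ n ∈ Finset.Icc ⌈Y⌉₊ ⌊Y + Y / H⌋₊, |a n| ^ 2 / (n : ℝ)) ≤ C / Real.log z ∧
      H * (∑ h ∈ Finset.Icc 1 ⌊X / T⌋₊, ∑ n ∈ Finset.Icc ⌈Y⌉₊ ⌊Y + Y / H⌋₊,
          |a n| * |a (n + h)| / (n : ℝ)) ≤ C * (X / T) / Real.log z ^ 2 := by
  obtain ⟨C, hC0, X₀, hC⟩ := exists_sum_card_sievedSet_pairs_short_le r hr
  refine ⟨2 * C + 1, by positivity, max X₀ 0,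
    fun X hX T hT Z hZ _ hZr z hz hzX a ha Y H hXY _ hH hHX => ?_⟩
  obtain ⟨hY0, hlz, hlzU, hM⟩ := hC X ((le_max_left _ _).trans hX) Z hZ z (hZr.trans hz) hzX Y H
    hXY hH hHX
  have hX0 : 0 ≤ X := (le_max_right _ _).trans hX
  have hH0 : 0 < H := zero_lt_one.trans_le hH
  set Q := sievedSet X r Z z
  set I := Finset.Icc ⌈Y⌉₊ ⌊Y + Y / H⌋₊
  set l := Real.log z
  have hIY : ∀ n ∈ I, Y ≤ n := fun n hn => Nat.ceil_le.1 (Finset.mem_Icc.1 hn).1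
  have ha1 : ∀ n, |a n| ≤ 1 := fun n => (ha n).trans (Set.indicator_le_self' (by simp) n)
  have ha0 : ∀ n, n ∉ Q → |a n| = 0 := fun n hn => le_antisymm
    ((ha n).trans_eq (Set.indicator_of_notMem hn _)) (abs_nonneg _)
  constructor
  · set F := I.filter (· ∈ Q)
    set t := Y / H / l with ht
    have ht1 : 1 ≤ t := (one_le_div hlz).2 hlzU
    have hFsub : F ⊆ Finset.Icc ⌈Y⌉₊ (⌈Y⌉₊ + ⌊Y / H⌋₊) := by
      intro n hn
      have hn' := Finset.mem_Icc.1 (Finset.mem_filter.1 hn).1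
      refine Finset.mem_Icc.2 ⟨hn'.1, ?_⟩
      have h1 : (n : ℝ) ≤ Y + Y / H := (Nat.le_floor_iff (by positivity)).1 hn'.2
      have h2 := Nat.le_ceil Y
      have h3 : n - ⌈Y⌉₊ ≤ ⌊Y / H⌋₊ := by
        refine Nat.le_floor ?_
        rw [Nat.cast_sub hn'.1]
        linarith
      omega
    have hpairs : ∑ h ∈ Finset.Icc 1 ⌊Y / H⌋₊, ((F.filter fun n => n + h ∈ F).card : ℝ) ≤
        C * t ^ 2 := by
      calc _ ≤ ∑ h ∈ Finset.Icc 1 ⌊Y / H⌋₊, ((I.filter fun n => n ∈ Q ∧ n + h ∈ Q).card : ℝ) := by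
            refine Finset.sum_le_sum fun h _ => Nat.cast_le.2 (Finset.card_le_card fun n hn => ?_)
            obtain ⟨h1, h2⟩ := Finset.mem_filter.1 hn
            obtain ⟨h3, h4⟩ := Finset.mem_filter.1 h1
            exact Finset.mem_filter.2 ⟨h3, h4, (Finset.mem_filter.1 h2).2⟩
        _ ≤ C * (Y / H) / l ^ 2 * (⌊Y / H⌋₊ : ℝ) := hM _
        _ ≤ C * (Y / H) / l ^ 2 * (Y / H) := by
            have := Nat.floor_le (a := Y / H) (by positivity)
            gcongr
        _ = _ := by rw [ht]; ring
    have hsq : (F.card : ℝ) ^ 2 ≤ F.card + 2 * (C * t ^ 2) := by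
      have h1 : (F.card : ℝ) ^ 2 ≤
          F.card + 2 * ∑ h ∈ Finset.Icc 1 ⌊Y / H⌋₊, ((F.filter fun n => n + h ∈ F).card : ℝ) := by
        exact_mod_cast card_sq_le_card_add_sum_pairs hFsub
      linarith
    have hFt : (F.card : ℝ) ≤ (2 * C + 1) * t := by
      by_contra! hlt
      have h1 : t ≤ F.card := by nlinarith
      nlinarith [mul_le_mul_of_nonneg_left h1 (mul_pos hC0 (zero_lt_one.trans_le ht1)).le]
    calc _ ≤ H * ∑ n ∈ I, if n ∈ Q then Y⁻¹ else 0 := by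
          refine mul_le_mul_of_nonneg_left (Finset.sum_le_sum fun n hn => ?_) hH0.le
          split_ifs with hnQ
          · have := hIY n hn
            rw [inv_eq_one_div]
            gcongr
            exact pow_le_one₀ (abs_nonneg _) (ha1 n)
          · simp [ha0 n hnQ]
      _ = H * F.card / Y := by
          rw [← Finset.sum_filter, Finset.sum_const, nsmul_eq_mul]
          ring
      _ ≤ H * ((2 * C + 1) * t) / Y := by gcongr
      _ = _ := by rw [ht]; field_simp
  · calc _ ≤ H * ∑ h ∈ Finset.Icc 1 ⌊X / T⌋₊, ∑ n ∈ I, if n ∈ Q ∧ n + h ∈ Q then Y⁻¹ else 0 := by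
          refine mul_le_mul_of_nonneg_left
            (Finset.sum_le_sum fun h _ => Finset.sum_le_sum fun n hn => ?_) hH0.le
          split_ifs with hnQ
          · have := hIY n hn
            rw [inv_eq_one_div]
            gcongr
            exact mul_le_one₀ (ha1 n) (abs_nonneg _) (ha1 _)
          · rcases not_and_or.1 hnQ with h1 | h1 <;> simp [ha0 _ h1]
      _ = H * (∑ h ∈ Finset.Icc 1 ⌊X / T⌋₊,
            ((I.filter fun n => n ∈ Q ∧ n + h ∈ Q).card : ℝ)) / Y := by
          simp_rw [← Finset.sum_filter, Finset.sum_const, nsmul_eq_mul]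
          rw [← Finset.sum_mul]
          ring
      _ ≤ H * (C * (Y / H) / l ^ 2 * (⌊X / T⌋₊ : ℝ)) / Y := by
          have := hM ⌊X / T⌋₊
          gcongr
      _ = C * (⌊X / T⌋₊ : ℝ) / l ^ 2 := by field_simp
      _ ≤ (2 * C + 1) * (X / T) / l ^ 2 := by
          have := Nat.floor_le (a := X / T) (by positivity)
          gcongr
          linarith
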